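/- Suppose reg I^n = dn + e for all n ≥ lin(I) and reg J^n = cn + f for all n ≥ lin(J), with c ≥ d. Set e* = max_{1 ≤ i ≤ lin(I)} { reg I^i − ci } and f* = max_{1 ≤ j ≤ lin(J)} { reg J^j − dj }. Then for all sufficiently large n: reg (I+J)^n = c(n+1) + f + e* − 1 if c > d, and reg (I+J)^n = d(n+1) + max{ f + e* , e + f* } − 1 if c = d. -/

import Mathlib

/-! Core definitions: depth via local cohomology at the maximal homogeneous ideal,
Castelnuovo–Mumford regularity via graded free resolutions, gradings on
subquotients of polynomial rings.  -/

open MvPolynomial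

noncomputable section

namespace PaperHTT

variable (k : Type) [Field k]

/-- A polynomial is homogeneous of degree `e : ℤ` (it must vanish in negative degrees). -/
def homogZ {σ : Type} (p : MvPolynomial σ k) (e : ℤ) : Prop :=
  p = 0 ∨ (0 ≤ e ∧ p.IsHomogeneous e.toNat)

/-- The maximal homogeneous ideal `(x_1, …, x_r)` of a polynomial ring. -/
def maxHomIdeal (σ : Type) : Ideal (MvPolynomial σ k) :=
  Ideal.span (Set.range MvPolynomial.X)

/-- The depth of a module over a polynomial ring with respect to the maximal homogeneous
ideal: the least `i` such that the `i`-th local cohomology is non-vanishing. -/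
def depthM {σ : Type} (M : ModuleCat (MvPolynomial σ k)) : ℕ :=
  sInf {i : ℕ | Nontrivial ((localCohomology (maxHomIdeal k σ) i).obj M)}

/-- The subquotient `p/q` of a polynomial ring, for ideals `q ≤ p`. -/
abbrev subQuot {σ : Type} (p q : Ideal (MvPolynomial σ k)) : Type :=
  ↥p ⧸ (Submodule.comap p.subtype q)

/-- The degree-`t` graded piece of `p/q`: the image of the homogeneous elements of
degree `t` of `p`. -/
def subQuotGr {σ : Type} (p q : Ideal (MvPolynomial σ k)) (t : ℤ) :
    AddSubgroup (subQuot k p q) :=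
  AddSubgroup.closure
    {x | ∃ f : p, homogZ k (f : MvPolynomial σ k) t ∧ x = Submodule.Quotient.mk f}

/-- The degree-`t` graded piece of the quotient ring `P/Q`. -/
def quotGr {σ : Type} (Q : Ideal (MvPolynomial σ k)) (t : ℤ) :
    AddSubgroup (MvPolynomial σ k ⧸ Q) :=
  AddSubgroup.closure {x | ∃ f, homogZ k f t ∧ x = Ideal.Quotient.mk Q f}

/-- The degree-`t` graded piece of an ideal `p`, viewed as a module. -/
def idealGr {σ : Type} (p : Ideal (MvPolynomial σ k)) (t : ℤ) : AddSubgroup ↥p :=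
  AddSubgroup.closure {x : p | homogZ k (x : MvPolynomial σ k) t}

/-- A finite graded free resolution of a module `M` over a polynomial ring,
with respect to a grading `gr` of `M`: `F_i` is free of rank `rk i`, with basis elements
of (twisted) degrees `tw i l`, the differentials and augmentation are graded of degree `0`,
and the complex `⋯ → F_1 → F_0 → M → 0` is exact. -/
structure GradedFreeRes (σ : Type) (M : Type) [AddCommGroup M]
    [Module (MvPolynomial σ k) M] (gr : ℤ → AddSubgroup M) where
  rk : ℕ → ℕ
  tw : (i : ℕ) → Fin (rk i) → ℤ
  bdd : ∃ N, ∀ i, N ≤ i → rk i = 0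
  aug : (Fin (rk 0) → MvPolynomial σ k) →ₗ[MvPolynomial σ k] M
  d : (i : ℕ) →
    ((Fin (rk (i + 1)) → MvPolynomial σ k) →ₗ[MvPolynomial σ k]
      (Fin (rk i) → MvPolynomial σ k))
  aug_surj : Function.Surjective aug
  exact_zero : LinearMap.range (d 0) = LinearMap.ker aug
  exact_succ : ∀ i, LinearMap.range (d (i + 1)) = LinearMap.ker (d i)
  aug_homog : ∀ l, aug (Pi.single l 1) ∈ gr (tw 0 l)
  d_homog : ∀ i l l', homogZ k (d i (Pi.single l 1) l') (tw (i + 1) l - tw i l')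

/-- The Castelnuovo–Mumford regularity of a (finitely generated) graded module over a
polynomial ring: the least `r` such that `M` admits a graded free resolution with all
twists in homological degree `i` at most `r + i`.  (By minimal free resolutions, this
agrees with `max {aⁱ(M) + i}`.) -/
def regM (σ : Type) (M : Type) [AddCommGroup M] [Module (MvPolynomial σ k) M]
    (gr : ℤ → AddSubgroup M) : ℤ :=
  sInf {r : ℤ | ∃ F : GradedFreeRes k σ M gr, ∀ i (l : Fin (F.rk i)), F.tw i l - (i : ℤ) ≤ r}

/-- Depth of the quotient ring `P/Q` as a module over `P`. -/
def depthQuot {σ : Type} (Q : Ideal (MvPolynomial σ k)) : ℕ :=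
  depthM k (ModuleCat.of (MvPolynomial σ k) (MvPolynomial σ k ⧸ Q))

/-- Depth of the subquotient `p/q` as a module over the polynomial ring. -/
def depthSubQuot {σ : Type} (p q : Ideal (MvPolynomial σ k)) : ℕ :=
  depthM k (ModuleCat.of (MvPolynomial σ k) (subQuot k p q))

/-- Depth of an ideal `p` as a module over the polynomial ring. -/
def depthIdeal {σ : Type} (p : Ideal (MvPolynomial σ k)) : ℕ :=
  depthM k (ModuleCat.of (MvPolynomial σ k) ↥p)

/-- Regularity of the quotient ring `P/Q`. -/
def regQuot {σ : Type} (Q : Ideal (MvPolynomial σ k)) : ℤ :=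
  regM k σ (MvPolynomial σ k ⧸ Q) (quotGr k Q)

/-- Regularity of the subquotient `p/q`. -/
def regSubQuot {σ : Type} (p q : Ideal (MvPolynomial σ k)) : ℤ :=
  regM k σ (subQuot k p q) (subQuotGr k p q)

/-- Regularity of an ideal `p`, viewed as a graded module. -/
def regIdeal {σ : Type} (p : Ideal (MvPolynomial σ k)) : ℤ :=
  regM k σ (↥p) (idealGr k p)

/-- A homogeneous ideal: one containing all homogeneous components of its elements. -/
def IsHomogeneousIdeal {σ : Type} (I : Ideal (MvPolynomial σ k)) : Prop :=
  ∀ f ∈ I, ∀ m : ℕ, MvPolynomial.homogeneousComponent m f ∈ I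

/-- A monomial ideal. -/
def IsMonomialIdeal {σ : Type} (I : Ideal (MvPolynomial σ k)) : Prop :=
  ∃ S : Set (σ →₀ ℕ), I = Ideal.span ((fun a => MvPolynomial.monomial a (1 : k)) '' S)

/-- A squarefree monomial ideal. -/
def IsSquarefreeMonomialIdeal {σ : Type} (I : Ideal (MvPolynomial σ k)) : Prop :=
  ∃ S : Set (σ →₀ ℕ), (∀ a ∈ S, ∀ x, a x ≤ 1) ∧
    I = Ideal.span ((fun a => MvPolynomial.monomial a (1 : k)) '' S)


/-- The quotient ring `P/Q` is Cohen–Macaulay: its depth equals its Krull dimension. -/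
def IsCMQuot {σ : Type} (Q : Ideal (MvPolynomial σ k)) : Prop :=
  (depthQuot k Q : WithBot (WithTop ℕ)) = ringKrullDim (MvPolynomial σ k ⧸ Q)

/-- An isomorphism of graded modules: a linear isomorphism matching up the gradings. -/
def GradedIso {P : Type} [CommRing P] {M N : Type} [AddCommGroup M] [Module P M]
    [AddCommGroup N] [Module P N] (grM : ℤ → AddSubgroup M) (grN : ℤ → AddSubgroup N) :
    Prop :=
  ∃ e : M ≃ₗ[P] N, ∀ t, (grM t).map e.toLinearMap.toAddMonoidHom = grN t

/-- `gr` is an (internal, ℤ-) grading of the module `M` over a polynomial ring,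
compatible with the standard grading of the polynomial ring. -/
def IsGrading (σ : Type) {M : Type} [AddCommGroup M] [Module (MvPolynomial σ k) M]
    (gr : ℤ → AddSubgroup M) : Prop :=
  DirectSum.IsInternal (fun t : ℤ => gr t) ∧
    ∀ (p : MvPolynomial σ k) (d : ℕ) (t : ℤ) (m : M), p.IsHomogeneous d → m ∈ gr t →
      p • m ∈ gr (t + d)

/-- The polynomial ring `A = k[x_1,…,x_r]`. -/
abbrev PA (r : ℕ) : Type := MvPolynomial (Fin r) k

/-- The polynomial ring `B = k[y_1,…,y_s]`. -/
abbrev PB (s : ℕ) : Type := MvPolynomial (Fin s) k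

/-- The polynomial ring `R = k[x_1,…,x_r,y_1,…,y_s]`. -/
abbrev PR (r s : ℕ) : Type := MvPolynomial (Fin r ⊕ Fin s) k

/-- The extension of an ideal `I ⊆ A` to `R`. -/
def extA {r s : ℕ} (I : Ideal (PA k r)) : Ideal (PR k r s) :=
  I.map (MvPolynomial.rename (Sum.inl : Fin r → Fin r ⊕ Fin s))

/-- The extension of an ideal `J ⊆ B` to `R`. -/
def extB {r s : ℕ} (J : Ideal (PB k s)) : Ideal (PR k r s) :=
  J.map (MvPolynomial.rename (Sum.inr : Fin s → Fin r ⊕ Fin s))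

/-- The ideal `I + J ⊆ R`. -/
def sumIJ {r s : ℕ} (I : Ideal (PA k r)) (J : Ideal (PB k s)) : Ideal (PR k r s) :=
  extA k I + extB k J

end PaperHTT

end

open MvPolynomial

namespace PaperHTT

noncomputable section

set_option linter.unusedSectionVars false

section KoszulDifferential

variable {k : Type} [Field k] {σ : Type} [Fintype σ] [DecidableEq σ]

/-- The sign of `i` relative to `T` in the ordering of the variables induced by `o`. -/
def ksgn (o : σ → ℕ) (i : σ) (T : Finset σ) : ℤ := (-1) ^ (T.filter (o · < o i)).card

omit [Fintype σ] in
theorem ksgn_insert (o : σ → ℕ) {i j : σ} {T : Finset σ} (hi : i ∉ T) :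
    ksgn o j (insert i T) = if o i < o j then - ksgn o j T else ksgn o j T := by
  unfold ksgn
  rw [Finset.filter_insert]
  split_ifs with h
  · rw [Finset.card_insert_of_notMem (by simp [hi]), pow_succ]; ring
  · rfl

omit [Fintype σ] in
theorem ksgn_mul_ksgn_insert {o : σ → ℕ} (ho : Function.Injective o) {i j : σ} {T : Finset σ}
    (hi : i ∉ T) (hj : j ∉ T) (hij : i ≠ j) :
    ksgn o i T * ksgn o j (insert i T) = -(ksgn o j T * ksgn o i (insert j T)) := by
  rw [ksgn_insert o hi, ksgn_insert o hj]
  have : o i ≠ o j := fun h => hij (ho h)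
  rcases lt_or_gt_of_ne this with h | h
  · rw [if_pos h, if_neg h.le.not_gt]; ring
  · rw [if_neg h.le.not_gt, if_pos h]; ring

variable {M : Type} [AddCommGroup M] [Module (MvPolynomial σ k) M]

/-- The Koszul differential on the variables with coefficients in `M`; a chain assigns to every
set `T` of variables the coefficient of the corresponding exterior basis element. -/
def kd (o : σ → ℕ) : (Finset σ → M) →ₗ[MvPolynomial σ k] (Finset σ → M) where
  toFun z T := ∑ i ∈ Tᶜ, ksgn o i T • (X i : MvPolynomial σ k) • z (insert i T)
  map_add' z w := by
    funext T
    simp [smul_add, Finset.sum_add_distrib]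
  map_smul' c z := by
    funext T
    simp only [Pi.smul_apply, RingHom.id_apply, Finset.smul_sum]
    refine Finset.sum_congr rfl fun i _ => ?_
    rw [smul_comm (X i : MvPolynomial σ k) c, smul_comm c (ksgn o i T)]

theorem kd_apply (o : σ → ℕ) (z : Finset σ → M) (T : Finset σ) :
    kd (k := k) o z T = ∑ i ∈ Tᶜ, ksgn o i T • (X i : MvPolynomial σ k) • z (insert i T) := rfl

theorem kd_kd {o : σ → ℕ} (ho : Function.Injective o) (z : Finset σ → M) :
    kd (k := k) o (kd (k := k) o z) = 0 := by
  funext T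
  simp only [kd_apply, Finset.smul_sum, Pi.zero_apply]
  rw [Finset.sum_sigma']
  refine Finset.sum_involution (fun a _ => ⟨a.2, a.1⟩) ?_ ?_ ?_ ?_
  · rintro ⟨i, j⟩ h
    simp only [Finset.mem_sigma, Finset.mem_compl, Finset.mem_insert, not_or] at h
    obtain ⟨hi, hji, hj⟩ := h
    have e1 : ksgn o i T • (X i : MvPolynomial σ k) • ksgn o j (insert i T) •
        (X j : MvPolynomial σ k) • z (insert j (insert i T)) =
        (ksgn o i T * ksgn o j (insert i T)) • ((X i * X j : MvPolynomial σ k) •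
          z (insert j (insert i T))) := by
      rw [smul_comm (X i : MvPolynomial σ k) (ksgn o j (insert i T)), smul_smul, smul_smul]
    have e2 : ksgn o j T • (X j : MvPolynomial σ k) • ksgn o i (insert j T) •
        (X i : MvPolynomial σ k) • z (insert i (insert j T)) =
        (ksgn o j T * ksgn o i (insert j T)) • ((X i * X j : MvPolynomial σ k) •
          z (insert j (insert i T))) := by
      rw [smul_comm (X j : MvPolynomial σ k) (ksgn o i (insert j T)), smul_smul, smul_smul,
        mul_comm (X j : MvPolynomial σ k), Finset.insert_comm]
    dsimp only
    rw [e1, e2, ← add_smul, ksgn_mul_ksgn_insert ho hi hj (Ne.symm hji), neg_add_cancel, zero_smul]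
  · rintro ⟨i, j⟩ h _ h'
    simp only [Finset.mem_sigma, Finset.mem_compl, Finset.mem_insert, not_or] at h
    simp only [Sigma.mk.injEq, heq_eq_eq] at h'
    exact h.2.1 h'.1
  · rintro ⟨i, j⟩ h
    simp only [Finset.mem_sigma, Finset.mem_compl, Finset.mem_insert, not_or] at h ⊢
    exact ⟨h.2.2, Ne.symm h.2.1, h.1⟩
  · rintro ⟨i, j⟩ h
    rfl

theorem kd_comp {N : Type} [AddCommGroup N] [Module (MvPolynomial σ k) N] (o : σ → ℕ)
    (φ : M →ₗ[MvPolynomial σ k] N) (z : Finset σ → M) :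
    kd (k := k) o (fun T => φ (z T)) = fun T => φ (kd (k := k) o z T) := by
  funext T
  simp [kd_apply, map_sum, map_zsmul]

theorem kd_mem (o : σ → ℕ) {N : Submodule (MvPolynomial σ k) M} {z : Finset σ → M}
    (hz : ∀ T, z T ∈ N) (T : Finset σ) : kd (k := k) o z T ∈ N := by
  rw [kd_apply]
  exact N.sum_mem fun i _ => zsmul_mem (N.smul_mem _ (hz _)) _

end KoszulDifferential

section HomogeneousPolynomials

variable {k : Type} [Field k] {σ : Type}

theorem homogZ_iff {p : MvPolynomial σ k} {e : ℤ} :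
    homogZ k p e ↔ ∀ a, coeff a p ≠ 0 → (a.degree : ℤ) = e := by
  constructor
  · rintro (rfl | ⟨he, h⟩) a ha
    · simp at ha
    · have := not_imp_comm.1 (h.coeff_eq_zero (d := a)) ha
      omega
  · intro h
    by_cases hp : p = 0
    · exact Or.inl hp
    · obtain ⟨a, ha⟩ := ne_zero_iff.1 hp
      have h1 := h a ha
      refine Or.inr ⟨by omega, ?_⟩
      intro b hb
      have h2 := h b hb
      have h3 : Finsupp.weight 1 b = Finsupp.degree b := by
        rw [Finsupp.degree_eq_weight_one]; rfl
      omega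

/-- The component of degree `t : ℤ` of a polynomial. -/
def compZ (t : ℤ) : MvPolynomial σ k →ₗ[k] MvPolynomial σ k :=
  if 0 ≤ t then homogeneousComponent t.toNat else 0

theorem coeff_compZ (t : ℤ) (p : MvPolynomial σ k) (a : σ →₀ ℕ) :
    coeff a (compZ t p) = if (a.degree : ℤ) = t then coeff a p else 0 := by
  unfold compZ
  by_cases ht : 0 ≤ t
  · rw [if_pos ht, coeff_homogeneousComponent]
    congr 1
    apply propext; omega
  · rw [if_neg ht, if_neg (by omega)]
    simp

theorem homogZ_compZ (t : ℤ) (p : MvPolynomial σ k) : homogZ k (compZ t p) t := by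
  rw [homogZ_iff]
  intro a ha
  rw [coeff_compZ] at ha
  by_contra h
  simp [h] at ha

theorem compZ_of_homogZ {t : ℤ} {p : MvPolynomial σ k} (hp : homogZ k p t) : compZ t p = p := by
  ext a
  rw [coeff_compZ]
  split_ifs with h
  · rfl
  · by_contra h'
    exact h (homogZ_iff.1 hp a (Ne.symm h'))

theorem compZ_of_ne {s t : ℤ} {p : MvPolynomial σ k} (hp : homogZ k p s) (hst : s ≠ t) :
    compZ t p = 0 := by
  ext a
  rw [coeff_compZ, coeff_zero]
  split_ifs with h
  · by_contra h'
    exact hst ((homogZ_iff.1 hp a h').symm.trans h)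
  · rfl

theorem homogZ_add {p q : MvPolynomial σ k} {t : ℤ} (hp : homogZ k p t) (hq : homogZ k q t) :
    homogZ k (p + q) t := by
  rw [← compZ_of_homogZ hp, ← compZ_of_homogZ hq, ← map_add]
  exact homogZ_compZ _ _

theorem homogZ_zero (t : ℤ) : homogZ k (0 : MvPolynomial σ k) t := Or.inl rfl

theorem homogZ_neg {p : MvPolynomial σ k} {t : ℤ} (hp : homogZ k p t) : homogZ k (-p) t := by
  rw [← compZ_of_homogZ hp, ← map_neg]
  exact homogZ_compZ _ _

theorem homogZ_mul {p q : MvPolynomial σ k} {s t : ℤ} (hp : homogZ k p s) (hq : homogZ k q t) :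
    homogZ k (p * q) (s + t) := by
  rcases hp with rfl | ⟨hs, hp⟩
  · left; simp
  rcases hq with rfl | ⟨ht, hq⟩
  · left; simp
  right
  refine ⟨by omega, ?_⟩
  rw [Int.toNat_add hs ht]
  exact hp.mul hq

theorem homogZ_X (i : σ) : homogZ k (X i : MvPolynomial σ k) 1 :=
  Or.inr ⟨by omega, isHomogeneous_X k i⟩

theorem homogZ_neg_degree {p : MvPolynomial σ k} {t : ℤ} (hp : homogZ k p t) (ht : t < 0) :
    p = 0 := by
  rcases hp with rfl | ⟨h, -⟩
  · rfl
  · omega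

theorem sum_compZ (p : MvPolynomial σ k) :
    p = ∑ i ∈ Finset.range (p.totalDegree + 1), compZ (i : ℤ) p := by
  conv_lhs => rw [← sum_homogeneousComponent p]
  refine Finset.sum_congr rfl fun i _ => ?_
  simp [compZ]

theorem compZ_mul_left {s : ℤ} {p : MvPolynomial σ k} (hp : homogZ k p s) (t : ℤ)
    (q : MvPolynomial σ k) : compZ t (p * q) = p * compZ (t - s) q := by
  have key (i : ℕ) : compZ t (p * compZ (i : ℤ) q) = p * compZ (t - s) (compZ (i : ℤ) q) := by
    by_cases h : s + i = t
    · rw [compZ_of_homogZ (h ▸ homogZ_mul hp (homogZ_compZ _ _)),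
        compZ_of_homogZ (t := t - s) (by rw [← h, add_sub_cancel_left]; exact homogZ_compZ _ _)]
    · rw [compZ_of_ne (homogZ_mul hp (homogZ_compZ _ _)) h,
        compZ_of_ne (homogZ_compZ _ _) (by omega), mul_zero]
  calc compZ t (p * q)
      = compZ t (p * ∑ i ∈ Finset.range (q.totalDegree + 1), compZ (i : ℤ) q) := by
        rw [← sum_compZ]
    _ = p * compZ (t - s) (∑ i ∈ Finset.range (q.totalDegree + 1), compZ (i : ℤ) q) := by
        simp only [Finset.mul_sum, map_sum, key]
    _ = p * compZ (t - s) q := by rw [← sum_compZ]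

end HomogeneousPolynomials

section KoszulHomotopy

variable {k : Type} [Field k] {σ : Type} [Fintype σ] [DecidableEq σ]

/-- Division by the variable `i` on the monomials whose smallest variable is `i`; all other
monomials are sent to zero. -/
def divMin (o : σ → ℕ) (i : σ) : MvPolynomial σ k →ₗ[k] MvPolynomial σ k :=
  (basisMonomials σ k).constr k fun a =>
    if a i ≠ 0 ∧ ∀ j, a j ≠ 0 → o i ≤ o j then monomial (a - Finsupp.single i 1) 1 else 0

theorem divMin_monomial (o : σ → ℕ) (i : σ) (a : σ →₀ ℕ) :
    divMin (k := k) o i (monomial a 1) =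
      if a i ≠ 0 ∧ ∀ j, a j ≠ 0 → o i ≤ o j then monomial (a - Finsupp.single i 1) 1 else 0 := by
  have := (basisMonomials σ k).constr_basis k (fun a => if a i ≠ 0 ∧ ∀ j, a j ≠ 0 → o i ≤ o j then
    (monomial (a - Finsupp.single i 1) 1 : MvPolynomial σ k) else 0) a
  rwa [coe_basisMonomials] at this

theorem linearMap_eq_of_monomial {V : Type} [AddCommGroup V] [Module k V]
    {f g : MvPolynomial σ k →ₗ[k] V} (h : ∀ a, f (monomial a 1) = g (monomial a 1))
    (p : MvPolynomial σ k) : f p = g p := by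
  have : f = g := (basisMonomials σ k).ext fun a => by simpa using h a
  rw [this]

theorem X_mul_divMin_monomial (o : σ → ℕ) (i : σ) (a : σ →₀ ℕ) :
    X i * divMin (k := k) o i (monomial a 1) =
      if a i ≠ 0 ∧ ∀ j, a j ≠ 0 → o i ≤ o j then monomial a 1 else 0 := by
  rw [divMin_monomial]
  split_ifs with h
  · rw [X, monomial_mul, one_mul, add_tsub_cancel_of_le]
    rw [Finsupp.single_le_iff]
    omega
  · simp

theorem X_mul_monomial_one (i : σ) (a : σ →₀ ℕ) :
    (X i * monomial a 1 : MvPolynomial σ k) = monomial (Finsupp.single i 1 + a : σ →₀ ℕ) 1 := by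
  rw [X, monomial_mul, one_mul]

theorem divMin_X_mul_of_lt {o : σ → ℕ} {i j : σ} (h : o j < o i) (p : MvPolynomial σ k) :
    divMin o i (X j * p) = 0 := by
  refine linearMap_eq_of_monomial (f := divMin o i ∘ₗ LinearMap.mulLeft k (X j)) (g := 0)
    (fun a => ?_) p
  simp only [LinearMap.comp_apply, LinearMap.mulLeft_apply, LinearMap.zero_apply]
  rw [X_mul_monomial_one, divMin_monomial, if_neg]
  rintro ⟨-, h'⟩
  have := h' j (by simp)
  omega

theorem divMin_X_mul_of_gt {o : σ → ℕ} {i j : σ} (h : o i < o j) (p : MvPolynomial σ k) :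
    divMin o i (X j * p) = X j * divMin o i p := by
  have hij : i ≠ j := by rintro rfl; omega
  refine linearMap_eq_of_monomial (f := divMin o i ∘ₗ LinearMap.mulLeft k (X j))
    (g := LinearMap.mulLeft k (X j) ∘ₗ divMin o i) (fun a => ?_) p
  simp only [LinearMap.comp_apply, LinearMap.mulLeft_apply]
  rw [X_mul_monomial_one, divMin_monomial, divMin_monomial]
  have hc : ((Finsupp.single j 1 + a : σ →₀ ℕ) i ≠ 0 ∧ ∀ l, (Finsupp.single j 1 + a : σ →₀ ℕ) l ≠ 0 → o i ≤ o l) ↔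
      (a i ≠ 0 ∧ ∀ l, a l ≠ 0 → o i ≤ o l) := by
    simp only [Finsupp.add_apply, Finsupp.single_apply, if_neg hij.symm, zero_add]
    refine and_congr_right fun _ => forall_congr' fun l => ?_
    by_cases hl : j = l
    · subst hl; simp [h.le]
    · simp [hl]
  simp only [hc]
  split_ifs with h'
  · rw [X_mul_monomial_one, add_tsub_assoc_of_le]
    rw [Finsupp.single_le_iff]; omega
  · simp

theorem divMin_X_mul_self_monomial (o : σ → ℕ) (i : σ) (a : σ →₀ ℕ) :
    divMin (k := k) o i (X i * monomial a 1) =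
      if ∀ j, a j ≠ 0 → o i ≤ o j then monomial a 1 else 0 := by
  rw [X_mul_monomial_one, divMin_monomial]
  have hc : ((Finsupp.single i 1 + a : σ →₀ ℕ) i ≠ 0 ∧ ∀ l, (Finsupp.single i 1 + a : σ →₀ ℕ) l ≠ 0 → o i ≤ o l) ↔
      (∀ l, a l ≠ 0 → o i ≤ o l) := by
    simp only [Finsupp.add_apply, Finsupp.single_apply]
    constructor
    · rintro ⟨-, h⟩ l hl
      exact h l (by omega)
    · intro h
      refine ⟨by simp, fun l hl => ?_⟩
      by_cases e : i = l
      · subst e; exact le_rfl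
      · exact h l (by simpa [e] using hl)
  simp only [hc, add_tsub_cancel_left]

theorem sum_X_mul_divMin_add {o : σ → ℕ} (ho : Function.Injective o) (i : σ)
    (p : MvPolynomial σ k) :
    ∑ j with o j < o i, X j * divMin o j p + divMin o i (X i * p) = p := by
  have hp := linearMap_eq_of_monomial
    (f := ∑ j with o j < o i, LinearMap.mulLeft k (X j) ∘ₗ divMin o j +
      divMin o i ∘ₗ LinearMap.mulLeft k (X i)) (g := LinearMap.id) ?_ p
  · simpa using hp
  · intro a
    simp only [LinearMap.add_apply, LinearMap.sum_apply, LinearMap.comp_apply,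
      LinearMap.mulLeft_apply, LinearMap.id_apply]
    rw [divMin_X_mul_self_monomial]
    simp only [X_mul_divMin_monomial]
    split_ifs with h
    · rw [Finset.sum_eq_zero, zero_add]
      intro j hj
      rw [if_neg]
      rintro ⟨h1, -⟩
      have := h j h1
      simp at hj; omega
    · push Not at h
      obtain ⟨j, hj, hji⟩ := h
      obtain ⟨m, hm, hmin⟩ := Finset.exists_min_image a.support o ⟨j, by simpa using hj⟩
      have hm' : a m ≠ 0 := by simpa using hm
      have hmin' : ∀ l, a l ≠ 0 → o m ≤ o l := fun l hl => hmin l (by simpa using hl)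
      rw [add_zero, Finset.sum_eq_single m]
      · rw [if_pos ⟨hm', hmin'⟩]
      · intro l _ hlm
        rw [if_neg]
        rintro ⟨h1, h2⟩
        exact hlm (ho (le_antisymm (h2 m hm') (hmin' l h1)))
      · intro hn
        have := hmin' j hj
        simp at hn; omega

theorem sum_X_mul_divMin {o : σ → ℕ} (ho : Function.Injective o) (p : MvPolynomial σ k)
    (hp : coeff 0 p = 0) : ∑ j, X j * divMin o j p = p := by
  have := linearMap_eq_of_monomial
    (f := ∑ j, LinearMap.mulLeft k (X j) ∘ₗ divMin o j)
    (g := LinearMap.id - (monomial 0) ∘ₗ (lcoeff k (0 : σ →₀ ℕ))) ?_ p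
  · simpa [hp] using this
  · intro a
    simp only [LinearMap.sum_apply, LinearMap.comp_apply, LinearMap.mulLeft_apply,
      LinearMap.id_apply, LinearMap.sub_apply, lcoeff_apply, coeff_monomial]
    simp only [X_mul_divMin_monomial]
    by_cases ha : a = 0
    · subst ha; simp
    · obtain ⟨j, hj⟩ := Finsupp.ne_iff.1 ha
      obtain ⟨m, hm, hmin⟩ := Finset.exists_min_image a.support o ⟨j, by simpa using hj⟩
      have hm' : a m ≠ 0 := by simpa using hm
      have hmin' : ∀ l, a l ≠ 0 → o m ≤ o l := fun l hl => hmin l (by simpa using hl)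
      rw [Finset.sum_eq_single m]
      · rw [if_pos ⟨hm', hmin'⟩]; simp [ha]
      · intro l _ hlm
        rw [if_neg]
        rintro ⟨h1, h2⟩
        exact hlm (ho (le_antisymm (h2 m hm') (hmin' l h1)))
      · simp

theorem compZ_divMin (o : σ → ℕ) (i : σ) (t : ℤ) (p : MvPolynomial σ k) :
    compZ (t - 1) (divMin o i p) = divMin o i (compZ t p) := by
  have hom (a : σ →₀ ℕ) : homogZ k (monomial a (1 : k)) a.degree := by
    rw [homogZ_iff]
    intro b hb
    rw [coeff_monomial] at hb
    by_contra hne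
    rw [if_neg (by rintro rfl; exact hne rfl)] at hb
    exact hb rfl
  refine linearMap_eq_of_monomial (f := compZ (t - 1) ∘ₗ divMin o i)
    (g := divMin o i ∘ₗ compZ t) (fun a => ?_) p
  simp only [LinearMap.comp_apply]
  have hD : homogZ k (divMin o i (monomial a (1 : k))) (a.degree - 1) := by
    rw [divMin_monomial]
    split_ifs with h
    · have h1 : a = (a - Finsupp.single i 1) + Finsupp.single i 1 := by
        rw [tsub_add_cancel_of_le]
        rw [Finsupp.single_le_iff]; omega
      have h2 : a.degree = (a - Finsupp.single i 1).degree + 1 := by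
        conv_lhs => rw [h1]
        simp
      have := hom (a - Finsupp.single i 1)
      have h3 : ((a - Finsupp.single i 1).degree : ℤ) = (a.degree : ℤ) - 1 := by omega
      rwa [h3] at this
    · exact homogZ_zero _
  by_cases h : (a.degree : ℤ) = t
  · rw [compZ_of_homogZ (h ▸ hD), compZ_of_homogZ (h ▸ hom a)]
  · rw [compZ_of_ne hD (by omega), compZ_of_ne (hom a) h, map_zero]

theorem homogZ_divMin (o : σ → ℕ) (i : σ) {t : ℤ} {p : MvPolynomial σ k} (hp : homogZ k p t) :
    homogZ k (divMin o i p) (t - 1) := by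
  rw [← compZ_of_homogZ hp, ← compZ_divMin]
  exact homogZ_compZ _ _

/-- The contracting homotopy of the Koszul complex of the polynomial ring. -/
def koszulHomotopy (o : σ → ℕ) (z : Finset σ → MvPolynomial σ k) (T : Finset σ) :
    MvPolynomial σ k :=
  ∑ i ∈ T, if ∀ j ∈ T, o i ≤ o j then divMin o i (z (T.erase i)) else 0

theorem koszulHomotopy_min {o : σ → ℕ} (ho : Function.Injective o)
    (z : Finset σ → MvPolynomial σ k) {T : Finset σ} {m : σ} (hm : m ∈ T)
    (hmin : ∀ j ∈ T, o m ≤ o j) :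
    koszulHomotopy o z T = divMin o m (z (T.erase m)) := by
  unfold koszulHomotopy
  rw [Finset.sum_eq_single m]
  · rw [if_pos hmin]
  · intro i hi him
    rw [if_neg]
    intro h
    exact him (ho (le_antisymm (h m hm) (hmin i hi)))
  · exact fun h => absurd hm h

theorem ksgn_eq_one {o : σ → ℕ} {i : σ} {T : Finset σ} (h : ∀ j ∈ T, o i ≤ o j) :
    ksgn o i T = 1 := by
  unfold ksgn
  rw [Finset.filter_false_of_mem, Finset.card_empty, pow_zero]
  intro j hj
  exact (h j hj).not_gt

theorem kd_koszulHomotopy_empty {o : σ → ℕ} (ho : Function.Injective o)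
    (z : Finset σ → MvPolynomial σ k) (hz : coeff 0 (z ∅) = 0) :
    kd (k := k) o (koszulHomotopy o z) ∅ = z ∅ := by
  rw [kd_apply, Finset.compl_empty]
  conv_rhs => rw [← sum_X_mul_divMin ho (z ∅) hz]
  refine Finset.sum_congr rfl fun i _ => ?_
  rw [ksgn_eq_one (by simp), one_smul, smul_eq_mul,
    koszulHomotopy_min ho z (m := i) (by simp) (by simp)]
  simp

theorem kd_koszulHomotopy_add {o : σ → ℕ} (ho : Function.Injective o)
    (z : Finset σ → MvPolynomial σ k) {T : Finset σ} (hT : T.Nonempty) :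
    kd (k := k) o (koszulHomotopy o z) T + koszulHomotopy o (kd (k := k) o z) T = z T := by
  obtain ⟨m, hm, hmin⟩ := Finset.exists_min_image T o hT
  have hcompl : (T.erase m)ᶜ = insert m Tᶜ := by
    ext j; simp only [Finset.mem_compl, Finset.mem_erase, Finset.mem_insert]; tauto
  rw [koszulHomotopy_min ho _ hm hmin, kd_apply, kd_apply, hcompl,
    Finset.sum_insert (by simpa using hm), Finset.insert_erase hm,
    ksgn_eq_one (fun j hj => hmin j (Finset.mem_of_mem_erase hj)), one_smul, smul_eq_mul,
    map_add, map_sum, add_left_comm, ← Finset.sum_add_distrib, add_comm]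
  conv_rhs => rw [← sum_X_mul_divMin_add ho m (z T)]
  congr 1
  have hsub : Finset.univ.filter (fun j => o j < o m) = Tᶜ.filter (fun j => o j < o m) := by
    ext j
    simp only [Finset.mem_filter, Finset.mem_univ, true_and, Finset.mem_compl]
    refine ⟨fun h => ⟨fun hj => ?_, h⟩, fun h => h.2⟩
    have := hmin j hj
    omega
  rw [hsub, Finset.sum_filter]
  refine Finset.sum_congr rfl fun j hj => ?_
  have hjT : j ∉ T := by simpa using hj
  have hjm : j ≠ m := by rintro rfl; exact hjT hm
  rw [map_zsmul, smul_eq_mul, smul_eq_mul]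
  split_ifs with h
  · rw [divMin_X_mul_of_lt h, smul_zero, add_zero, ksgn_eq_one (fun l hl => h.le.trans (hmin l hl)),
      one_smul, koszulHomotopy_min ho z (m := j) (by simp), Finset.erase_insert hjT]
    intro l hl
    rcases Finset.mem_insert.1 hl with rfl | hl
    · exact le_rfl
    · exact h.le.trans (hmin l hl)
  · have hlt : o m < o j := lt_of_le_of_ne (not_lt.1 h) fun e => hjm (ho e).symm
    rw [divMin_X_mul_of_gt hlt, koszulHomotopy_min ho z (m := m) (by simp [hm])]
    · have h1 : ksgn o j T = - ksgn o j (T.erase m) := by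
        conv_lhs => rw [← Finset.insert_erase hm]
        rw [ksgn_insert o (by simp), if_pos hlt]
      rw [h1, Finset.erase_insert_of_ne hjm, neg_smul, neg_add_cancel]
    · intro l hl
      rcases Finset.mem_insert.1 hl with rfl | hl
      · exact hlt.le
      · exact hmin l hl

theorem kd_koszulHomotopy {o : σ → ℕ} (ho : Function.Injective o)
    {z : Finset σ → MvPolynomial σ k} (hz : coeff 0 (z ∅) = 0) (hd : kd (k := k) o z = 0) :
    kd (k := k) o (koszulHomotopy o z) = z := by
  funext T
  rcases T.eq_empty_or_nonempty with rfl | hT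
  · exact kd_koszulHomotopy_empty ho z hz
  · have := kd_koszulHomotopy_add ho z hT
    rw [hd] at this
    rw [← this]
    simp [koszulHomotopy]

theorem homogZ_koszulHomotopy (o : σ → ℕ) {z : Finset σ → MvPolynomial σ k} {t : ℤ}
    (hz : ∀ T, homogZ k (z T) t) (T : Finset σ) : homogZ k (koszulHomotopy o z T) (t - 1) := by
  unfold koszulHomotopy
  refine Finset.sum_induction _ (fun p => homogZ k p (t - 1)) (fun _ _ => homogZ_add)
    (homogZ_zero _) fun i _ => ?_
  split_ifs
  · exact homogZ_divMin o i (hz _)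
  · exact homogZ_zero _

theorem koszulHomotopy_eq_zero (o : σ → ℕ) {z : Finset σ → MvPolynomial σ k} {c : ℕ}
    (hz : ∀ T, T.card < c → z T = 0) (T : Finset σ) (hT : T.card < c + 1) :
    koszulHomotopy o z T = 0 := by
  unfold koszulHomotopy
  refine Finset.sum_eq_zero fun i hi => ?_
  have : 0 < T.card := Finset.card_pos.2 ⟨i, hi⟩
  rw [hz _ (by rw [Finset.card_erase_of_mem hi]; omega), map_zero, ite_self]

end KoszulHomotopy

section GradedModules

variable {k : Type} [Field k] {σ : Type} [Fintype σ] [DecidableEq σ]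
variable {M : Type} [AddCommGroup M] [Module (MvPolynomial σ k) M]

/-- The projections onto the graded pieces of a graded module that is bounded below. -/
structure GradedData (k : Type) [Field k] {σ : Type} {M : Type} [AddCommGroup M]
    [Module (MvPolynomial σ k) M] (gr : ℤ → AddSubgroup M) where
  comp : ℤ → M →+ M
  comp_mem : ∀ t m, comp t m ∈ gr t
  comp_self : ∀ {t m}, m ∈ gr t → comp t m = m
  comp_ne : ∀ {s t m}, m ∈ gr s → s ≠ t → comp t m = 0
  sum_comp : ∀ m, ∃ s : Finset ℤ, m = ∑ t ∈ s, comp t m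
  smul_mem : ∀ {p : MvPolynomial σ k} {d t : ℤ} {m : M}, homogZ k p d → m ∈ gr t →
    p • m ∈ gr (t + d)
  bdd : ∃ t₀, ∀ t < t₀, gr t = ⊥

namespace GradedData

variable {gr : ℤ → AddSubgroup M} (G : GradedData k (σ := σ) gr)
include G

theorem comp_smul {p : MvPolynomial σ k} {d : ℤ} (hp : homogZ k p d) (t : ℤ) (m : M) :
    G.comp t (p • m) = p • G.comp (t - d) m := by
  have key (i : ℤ) : G.comp t (p • G.comp i m) = p • G.comp (t - d) (G.comp i m) := by
    by_cases h : i + d = t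
    · rw [G.comp_self (h ▸ G.smul_mem hp (G.comp_mem _ _)),
        G.comp_self (t := t - d) (by rw [← h, add_sub_cancel_right]; exact G.comp_mem _ _)]
    · rw [G.comp_ne (G.smul_mem hp (G.comp_mem _ _)) h,
        G.comp_ne (G.comp_mem _ _) (by omega), smul_zero]
  obtain ⟨s, hs⟩ := G.sum_comp m
  rw [hs]
  simp only [Finset.smul_sum, map_sum, key]

theorem comp_smul_of_mem (p : MvPolynomial σ k) {t : ℤ} {m : M} (hm : m ∈ gr t) (u : ℤ) :
    G.comp u (p • m) = compZ (u - t) p • m := by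
  have key (i : ℕ) : G.comp u (compZ (i : ℤ) p • m) = compZ (u - t) (compZ (i : ℤ) p) • m := by
    rw [G.comp_smul (homogZ_compZ _ _)]
    by_cases h : t = u - i
    · rw [← h, G.comp_self hm, show u - t = i by omega, compZ_of_homogZ (homogZ_compZ (i : ℤ) p)]
    · rw [G.comp_ne hm h, compZ_of_ne (homogZ_compZ _ _) (by omega), smul_zero, zero_smul]
  rw [sum_compZ p]
  simp only [Finset.sum_smul, map_sum, key]

theorem comp_kd (o : σ → ℕ) (t : ℤ) (z : Finset σ → M) (T : Finset σ) :
    G.comp t (kd (k := k) o z T) = kd (k := k) o (fun T => G.comp (t - 1) (z T)) T := by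
  simp only [kd_apply, map_sum, map_zsmul, G.comp_smul (homogZ_X _)]

theorem kd_mem_gr (o : σ → ℕ) {u : ℤ} {z : Finset σ → M} (hz : ∀ T, z T ∈ gr u) (T : Finset σ) :
    kd (k := k) o z T ∈ gr (u + 1) := by
  rw [kd_apply]
  exact (gr (u + 1)).sum_mem fun i _ => (gr (u + 1)).zsmul_mem (G.smul_mem (homogZ_X i) (hz _)) _

theorem span_homogeneous : Submodule.span (MvPolynomial σ k) {m : M | ∃ t, m ∈ gr t} = ⊤ := by
  rw [eq_top_iff]
  intro m _
  obtain ⟨s, hs⟩ := G.sum_comp m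
  rw [hs]
  exact Submodule.sum_mem _ fun t _ => Submodule.subset_span ⟨t, G.comp_mem _ _⟩

theorem subsingleton_of_gr (h : ∀ t, gr t = ⊥) : Subsingleton M := by
  refine subsingleton_of_forall_eq 0 fun m => ?_
  obtain ⟨s, hs⟩ := G.sum_comp m
  rw [hs]
  refine Finset.sum_eq_zero fun t _ => ?_
  have := G.comp_mem t m
  rwa [h, AddSubgroup.mem_bot] at this

theorem exists_minimal_degree [Nontrivial M] :
    ∃ t, gr t ≠ ⊥ ∧ ∀ s < t, gr s = ⊥ := by
  have hex : ∃ t, gr t ≠ ⊥ := by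
    by_contra! h
    exact not_subsingleton M (G.subsingleton_of_gr h)
  obtain ⟨t₀, ht₀⟩ := G.bdd
  obtain ⟨t, ht, hmin⟩ := Int.exists_least_of_bdd (P := fun t => gr t ≠ ⊥)
    ⟨t₀, fun z hz => by by_contra! h; exact hz (ht₀ z h)⟩ hex
  exact ⟨t, ht, fun s hs => by by_contra h; exact absurd (hmin s h) (by omega)⟩

/-- A submodule that is stable under the projections onto the graded pieces is graded. -/
def submodule (N : Submodule (MvPolynomial σ k) M) (hN : ∀ t, ∀ m ∈ N, G.comp t m ∈ N) :
    GradedData k (σ := σ) (fun t => (gr t).comap N.subtype.toAddMonoidHom) where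
  comp t := ((G.comp t).comp N.subtype.toAddMonoidHom).codRestrict N.toAddSubgroup
    fun m => hN t m.1 m.2
  comp_mem t m := G.comp_mem t m.1
  comp_self h := Subtype.ext (G.comp_self h)
  comp_ne h hs := Subtype.ext (G.comp_ne h hs)
  sum_comp m := by
    obtain ⟨s, hs⟩ := G.sum_comp m.1
    refine ⟨s, Subtype.ext ?_⟩
    conv_lhs => rw [hs]
    rw [AddSubmonoidClass.coe_finsetSum]
    rfl
  smul_mem hp hm := G.smul_mem hp hm
  bdd := by
    obtain ⟨t₀, h⟩ := G.bdd
    refine ⟨t₀, fun t ht => ?_⟩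
    rw [eq_bot_iff]
    intro m hm
    have hm' : m.1 ∈ gr t := hm
    rw [h t ht] at hm'
    exact Subtype.ext hm'

end GradedData

/-- The grading of a free module with basis elements of degrees `tw`. -/
def freeGr (k : Type) [Field k] (σ : Type) {g : ℕ} (tw : Fin g → ℤ) (t : ℤ) :
    AddSubgroup (Fin g → MvPolynomial σ k) where
  carrier := {f | ∀ l, homogZ k (f l) (t - tw l)}
  add_mem' hf hg l := homogZ_add (hf l) (hg l)
  zero_mem' _ := homogZ_zero _
  neg_mem' hf l := homogZ_neg (hf l)

/-- The graded pieces of a free module. -/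
def freeGradedData {g : ℕ} (tw : Fin g → ℤ) : GradedData k (σ := σ) (freeGr k σ tw) where
  comp t :=
    { toFun := fun f l => compZ (t - tw l) (f l)
      map_zero' := by funext l; simp
      map_add' := fun f g => by funext l; simp }
  comp_mem t f l := homogZ_compZ _ _
  comp_self h := by funext l; exact compZ_of_homogZ (h l)
  comp_ne h hs := by funext l; exact compZ_of_ne (h l) (by omega)
  sum_comp f := by
    have hl (l : Fin g) : ∃ s : Finset ℤ, ∀ s', s ⊆ s' → f l = ∑ t ∈ s', compZ (t - tw l) (f l) := by
      refine ⟨(Finset.range ((f l).totalDegree + 1)).image (fun i : ℕ => (i : ℤ) + tw l),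
        fun s' hs' => ?_⟩
      rw [← Finset.sum_subset hs', Finset.sum_image (by simp)]
      · simpa using sum_compZ (f l)
      · intro t _ ht
        ext a
        rw [coeff_compZ, coeff_zero]
        split_ifs with ha
        · by_contra hne
          have := le_totalDegree (mem_support_iff.2 hne)
          refine ht (Finset.mem_image.2 ⟨a.degree, ?_, by omega⟩)
          rw [Finset.mem_range]
          exact Nat.lt_succ_of_le this
        · rfl
    choose s hs using hl
    refine ⟨Finset.univ.biUnion s, ?_⟩
    funext l
    rw [Finset.sum_apply]
    exact hs l _ (Finset.subset_biUnion_of_mem s (Finset.mem_univ l))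
  smul_mem {p d t m} hp hm l := by
    have := homogZ_mul hp (hm l)
    rwa [show d + (t - tw l) = t + d - tw l by omega] at this
  bdd := by
    obtain ⟨t₀, h⟩ := (Set.finite_range tw).bddBelow
    refine ⟨t₀, fun t ht => ?_⟩
    rw [eq_bot_iff]
    intro f hf
    rw [AddSubgroup.mem_bot]
    funext l
    have := h ⟨l, rfl⟩
    exact homogZ_neg_degree (hf l) (by omega)

theorem aug_comp {gr : ℤ → AddSubgroup M} (G : GradedData k (σ := σ) gr) {g : ℕ} {tw : Fin g → ℤ}
    (φ : (Fin g → MvPolynomial σ k) →ₗ[MvPolynomial σ k] M)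
    (hφ : ∀ l, φ (Pi.single l 1) ∈ gr (tw l)) (t : ℤ) (f : Fin g → MvPolynomial σ k) :
    φ ((freeGradedData tw).comp t f) = G.comp t (φ f) := by
  have key (f : Fin g → MvPolynomial σ k) : φ f = ∑ l, f l • φ (Pi.single l 1) := by
    conv_lhs => rw [← LinearMap.sum_single_apply (fun _ => MvPolynomial σ k) f]
    rw [map_sum]
    refine Finset.sum_congr rfl fun l _ => ?_
    rw [← map_smul, ← Pi.single_smul, smul_eq_mul, mul_one]
  rw [key, key f, map_sum]
  refine Finset.sum_congr rfl fun l _ => ?_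
  rw [G.comp_smul_of_mem _ (hφ l)]
  rfl

/-- The strand of the Koszul complex of `M` through internal degree `u` is exact at every
homological spot for all `u > ρ`. -/
def KReg (k : Type) [Field k] {σ : Type} [Fintype σ] [DecidableEq σ] {M : Type} [AddCommGroup M]
    [Module (MvPolynomial σ k) M] (o : σ → ℕ) (gr : ℤ → AddSubgroup M) (ρ : ℤ) : Prop :=
  ∀ u > ρ, ∀ z : Finset σ → M, (∀ T, z T ∈ gr u) → kd (k := k) o z = 0 →
    ∃ w : Finset σ → M, (∀ T, w T ∈ gr (u - 1)) ∧ kd (k := k) o w = z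

/-- The Koszul complex of `M` is exact in homological degrees at least `c`. -/
def KVan (k : Type) [Field k] {σ : Type} [Fintype σ] [DecidableEq σ] (M : Type) [AddCommGroup M]
    [Module (MvPolynomial σ k) M] (o : σ → ℕ) (c : ℕ) : Prop :=
  ∀ z : Finset σ → M, (∀ T, T.card < c → z T = 0) → kd (k := k) o z = 0 →
    ∃ w : Finset σ → M, kd (k := k) o w = z

theorem kd_pi_apply {g : ℕ} (o : σ → ℕ) (z : Finset σ → Fin g → MvPolynomial σ k) (T : Finset σ)
    (l : Fin g) : kd (k := k) o z T l = kd (k := k) o (fun T => z T l) T := by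
  simp only [kd_apply, Finset.sum_apply, Pi.smul_apply]

theorem exists_kd_free {o : σ → ℕ} (ho : Function.Injective o) {g : ℕ}
    {z : Finset σ → Fin g → MvPolynomial σ k} (hz : ∀ l, coeff 0 (z ∅ l) = 0)
    (hd : kd (k := k) o z = 0) :
    kd (k := k) o (fun T l => koszulHomotopy o (fun T => z T l) T) = z := by
  funext T l
  rw [kd_pi_apply]
  exact congrFun (kd_koszulHomotopy ho (hz l)
    (by funext T; rw [← kd_pi_apply, hd]; rfl)) T

theorem exists_kd_free_gr {o : σ → ℕ} (ho : Function.Injective o) {g : ℕ} {tw : Fin g → ℤ} {u : ℤ}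
    (hu : ∀ l, tw l < u) {z : Finset σ → Fin g → MvPolynomial σ k}
    (hz : ∀ T, z T ∈ freeGr k σ tw u) (hd : kd (k := k) o z = 0) :
    ∃ w : Finset σ → Fin g → MvPolynomial σ k,
      (∀ T, w T ∈ freeGr k σ tw (u - 1)) ∧ kd (k := k) o w = z := by
  refine ⟨_, fun T l => ?_, exists_kd_free ho (fun l => ?_) hd⟩
  · have := homogZ_koszulHomotopy o (fun T => hz T l) T
    rwa [show u - 1 - tw l = u - tw l - 1 by omega]
  · by_contra hne
    have h1 := homogZ_iff.1 (hz ∅ l) 0 hne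
    have := hu l
    simp at h1
    omega

section DimensionShift

variable {gr : ℤ → AddSubgroup M} (G : GradedData k (σ := σ) gr) {g : ℕ} {tw : Fin g → ℤ}
  {φ : (Fin g → MvPolynomial σ k) →ₗ[MvPolynomial σ k] M}
  (hφ : ∀ l, φ (Pi.single l 1) ∈ gr (tw l))

/-- The grading on the kernel of a graded map from a graded free module. -/
abbrev kerGr (φ : (Fin g → MvPolynomial σ k) →ₗ[MvPolynomial σ k] M) (tw : Fin g → ℤ) (t : ℤ) :
    AddSubgroup (LinearMap.ker φ) :=
  (freeGr k σ tw t).comap (LinearMap.ker φ).subtype.toAddMonoidHom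

/-- The kernel of a graded map is graded. -/
def kerGradedData : GradedData k (σ := σ) (kerGr φ tw) :=
  (freeGradedData tw).submodule (LinearMap.ker φ) fun t m hm => by
    rw [LinearMap.mem_ker] at hm ⊢
    rw [aug_comp G φ hφ, hm, map_zero]

theorem lift_chain {z : Finset σ → Fin g → MvPolynomial σ k} {o : σ → ℕ}
    (hz : ∀ T, φ (kd (k := k) o z T) = 0) :
    ∃ y : Finset σ → LinearMap.ker φ, (fun T => (y T : Fin g → MvPolynomial σ k)) =
      kd (k := k) o z :=
  ⟨fun T => ⟨_, hz T⟩, rfl⟩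

include G hφ in
theorem exists_homogeneous_lift (hs : Function.Surjective φ) {u : ℤ} {m : M} (hm : m ∈ gr u) :
    ∃ f ∈ freeGr k σ tw u, φ f = m := by
  obtain ⟨f, rfl⟩ := hs m
  exact ⟨_, (freeGradedData tw).comp_mem u f, by rw [aug_comp G φ hφ, G.comp_self hm]⟩

theorem aug_mem_gr {u : ℤ} {f : Fin g → MvPolynomial σ k} (hf : f ∈ freeGr k σ tw u)
    (G : GradedData k (σ := σ) gr) (hφ : ∀ l, φ (Pi.single l 1) ∈ gr (tw l)) : φ f ∈ gr u := by
  rw [← (freeGradedData tw).comp_self hf, aug_comp G φ hφ]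
  exact G.comp_mem _ _

theorem kd_ker_coe (o : σ → ℕ) (y : Finset σ → LinearMap.ker φ) :
    (fun T => ((kd (k := k) o y T : LinearMap.ker φ) : Fin g → MvPolynomial σ k)) =
      kd (k := k) o (fun T => (y T : Fin g → MvPolynomial σ k)) :=
  (kd_comp o (LinearMap.ker φ).subtype y).symm

include G hφ in
theorem KReg.of_ker {o : σ → ℕ} (ho : Function.Injective o) (hs : Function.Surjective φ) {ρ : ℤ}
    (htw : ∀ l, tw l ≤ ρ) (hK : KReg k o (kerGr φ tw) (ρ + 1)) : KReg k o gr ρ := by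
  intro u hu z hz hd
  choose f hf hfz using fun T => exists_homogeneous_lift G hφ hs (hz T)
  have hdf : ∀ T, φ (kd (k := k) o f T) = 0 := fun T => by
    have := congrFun (kd_comp o φ f) T
    rw [← this]
    simp only [hfz]
    rw [show (fun T => z T) = z from rfl, hd]; rfl
  obtain ⟨y, hy⟩ := lift_chain hdf
  obtain ⟨w, hw, hwy⟩ := hK (u + 1) (by omega) y
    (fun T => by
      have : (y T : Fin g → MvPolynomial σ k) ∈ freeGr k σ tw (u + 1) := by
        rw [show (y T : Fin g → MvPolynomial σ k) = kd (k := k) o f T from congrFun hy T]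
        exact (freeGradedData tw).kd_mem_gr o hf T
      exact this)
    (by
      funext T
      apply Subtype.ext
      have := congrFun (kd_ker_coe o y) T
      rw [this, hy, kd_kd ho]; rfl)
  rw [add_sub_cancel_right] at hw
  obtain ⟨v, hv, hvf⟩ := exists_kd_free_gr ho (tw := tw) (u := u) (fun l => by linarith [htw l])
    (z := f - fun T => (w T : Fin g → MvPolynomial σ k))
    (fun T => AddSubgroup.sub_mem _ (hf T) (hw T))
    (by rw [map_sub, ← kd_ker_coe, hwy, hy, sub_self])
  refine ⟨fun T => φ (v T), fun T => aug_mem_gr (hv T) G hφ, ?_⟩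
  rw [kd_comp, hvf]
  funext T
  rw [Pi.sub_apply, map_sub, hfz, (w T).2, sub_zero]

include G hφ in
theorem KReg.ker {o : σ → ℕ} (ho : Function.Injective o) (hs : Function.Surjective φ) {ρ : ℤ}
    (htw : ∀ l, tw l ≤ ρ) (hM : KReg k o gr ρ) : KReg k o (kerGr φ tw) (ρ + 1) := by
  intro u hu z hz hd
  obtain ⟨w, hw, hwz⟩ := exists_kd_free_gr ho (tw := tw) (u := u) (fun l => by linarith [htw l])
    (z := fun T => (z T : Fin g → MvPolynomial σ k)) hz (by rw [← kd_ker_coe, hd]; rfl)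
  obtain ⟨v, hv, hvw⟩ := hM (u - 1) (by omega) (fun T => φ (w T))
    (fun T => aug_mem_gr (hw T) G hφ) (by
      rw [kd_comp, hwz]
      funext T
      exact (z T).2)
  choose f hf hfv using fun T => exists_homogeneous_lift G hφ hs (hv T)
  have hker (T : Finset σ) : φ (w T - kd (k := k) o f T) = 0 := by
    have h1 := congrFun (kd_comp o φ f) T
    simp only [hfv] at h1
    rw [map_sub, ← h1, show (fun T => v T) = v from rfl, hvw, sub_self]
  refine ⟨fun T => ⟨_, hker T⟩, fun T => ?_, ?_⟩
  · have h2 := (freeGradedData tw).kd_mem_gr o hf T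
    rw [sub_add_cancel] at h2
    exact AddSubgroup.sub_mem _ (hw T) h2
  · funext T
    apply Subtype.ext
    refine (congrFun (kd_ker_coe o _) T).trans ?_
    change kd (k := k) o (w - kd (k := k) o f) T = _
    rw [map_sub, kd_kd ho, sub_zero, hwz]

theorem KVan.ker {o : σ → ℕ} (ho : Function.Injective o) (hs : Function.Surjective φ) {c : ℕ}
    (hmin : ∀ f, φ f = 0 → ∀ l, coeff 0 (f l) = 0) (hM : KVan k M o (c + 1)) :
    KVan k (LinearMap.ker φ) o c := by
  intro z hz hd
  have hwz := exists_kd_free ho (z := fun T => (z T : Fin g → MvPolynomial σ k))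
    (fun l => hmin _ (z ∅).2 l) (by rw [← kd_ker_coe, hd]; rfl)
  set w : Finset σ → Fin g → MvPolynomial σ k :=
    fun T l => koszulHomotopy o (fun T => (z T : Fin g → MvPolynomial σ k) l) T with hw
  obtain ⟨v, hvw⟩ := hM (fun T => φ (w T)) (fun T hT => by
      have : w T = 0 := by
        funext l
        exact koszulHomotopy_eq_zero o (c := c) (fun T hT => by rw [hz T hT]; rfl) T hT
      rw [this, map_zero]) (by
      rw [kd_comp, hwz]
      funext T
      exact (z T).2)
  choose f hfv using fun T => hs (v T)
  have hker (T : Finset σ) : φ (w T - kd (k := k) o f T) = 0 := by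
    have h1 := congrFun (kd_comp o φ f) T
    simp only [hfv] at h1
    rw [map_sub, ← h1, show (fun T => v T) = v from rfl, hvw, sub_self]
  refine ⟨fun T => ⟨_, hker T⟩, ?_⟩
  funext T
  apply Subtype.ext
  refine (congrFun (kd_ker_coe o _) T).trans ?_
  change kd (k := k) o (w - kd (k := k) o f) T = _
  rw [map_sub, kd_kd ho, sub_zero, hwz]

end DimensionShift

end GradedModules

section Resolutions

variable {k : Type} [Field k] {σ : Type} [Fintype σ] [DecidableEq σ]
variable {M : Type} [AddCommGroup M] [Module (MvPolynomial σ k) M]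

theorem kd_single_empty {o : σ → ℕ} (m : M) :
    kd (k := k) o (fun T => if T = ∅ then m else 0) = 0 := by
  funext T
  rw [kd_apply]
  refine Finset.sum_eq_zero fun i _ => ?_
  rw [if_neg (Finset.insert_ne_empty _ _), smul_zero, smul_zero]

theorem kd_apply_empty {o : σ → ℕ} (w : Finset σ → M) :
    kd (k := k) o w ∅ = ∑ i, (X i : MvPolynomial σ k) • w {i} := by
  rw [kd_apply, Finset.compl_empty]
  refine Finset.sum_congr rfl fun i _ => ?_
  rw [ksgn_eq_one (by simp), one_smul]
  rfl

theorem GradedData.subsingleton_of_kVan {gr : ℤ → AddSubgroup M} (G : GradedData k (σ := σ) gr)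
    {o : σ → ℕ} (h : KVan k M o 0) : Subsingleton M := by
  by_contra hne
  rw [not_subsingleton_iff_nontrivial] at hne
  obtain ⟨t, ht, hmin⟩ := G.exists_minimal_degree
  refine ht (eq_bot_iff.2 fun m hm => ?_)
  obtain ⟨w, hw⟩ := h (fun T => if T = ∅ then m else 0) (by simp) (kd_single_empty m)
  have h1 := congrFun hw ∅
  rw [if_pos rfl] at h1
  rw [AddSubgroup.mem_bot, ← G.comp_self hm, ← h1, G.comp_kd, kd_apply]
  refine Finset.sum_eq_zero fun i _ => ?_
  have h2 := G.comp_mem (t - 1) (w (insert i ∅))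
  rw [hmin _ (by omega), AddSubgroup.mem_bot] at h2
  rw [h2, smul_zero, smul_zero]

/-- Prepend a graded free cover to a resolution of its kernel. -/
def GradedFreeRes.cons {gr : ℤ → AddSubgroup M} {g : ℕ} {tw : Fin g → ℤ}
    {φ : (Fin g → MvPolynomial σ k) →ₗ[MvPolynomial σ k] M}
    (hφ : ∀ l, φ (Pi.single l 1) ∈ gr (tw l)) (hs : Function.Surjective φ)
    (F : GradedFreeRes k σ (LinearMap.ker φ) (kerGr φ tw)) : GradedFreeRes k σ M gr where
  rk i := match i with
    | 0 => g
    | i + 1 => F.rk i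
  tw i := match i with
    | 0 => tw
    | i + 1 => F.tw i
  bdd := by
    obtain ⟨N, hN⟩ := F.bdd
    refine ⟨N + 1, fun i hi => ?_⟩
    cases i with
    | zero => omega
    | succ i => exact hN i (by omega)
  aug := φ
  d i := match i with
    | 0 => (LinearMap.ker φ).subtype ∘ₗ F.aug
    | i + 1 => F.d i
  aug_surj := hs
  exact_zero := by
    change LinearMap.range ((LinearMap.ker φ).subtype ∘ₗ F.aug) = _
    rw [LinearMap.range_comp_of_range_eq_top _ (LinearMap.range_eq_top.2 F.aug_surj),
      Submodule.range_subtype]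
  exact_succ i := by
    cases i with
    | zero =>
      change LinearMap.range (F.d 0) = LinearMap.ker ((LinearMap.ker φ).subtype ∘ₗ F.aug)
      rw [F.exact_zero, LinearMap.ker_comp_of_ker_eq_bot _ (Submodule.ker_subtype _)]
    | succ i => exact F.exact_succ i
  aug_homog := hφ
  d_homog i := by
    cases i with
    | zero => exact fun l l' => F.aug_homog l l'
    | succ i => exact F.d_homog i

/-- The resolution of the kernel of the augmentation obtained by dropping the first module. -/
def GradedFreeRes.tail {gr : ℤ → AddSubgroup M} (F : GradedFreeRes k σ M gr) :
    GradedFreeRes k σ (LinearMap.ker F.aug) (kerGr F.aug (F.tw 0)) where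
  rk i := F.rk (i + 1)
  tw i := F.tw (i + 1)
  bdd := by
    obtain ⟨N, hN⟩ := F.bdd
    exact ⟨N, fun i hi => hN _ (by omega)⟩
  aug := (F.d 0).codRestrict _ fun f => by
    rw [← F.exact_zero]; exact LinearMap.mem_range_self _ _
  d i := F.d (i + 1)
  aug_surj := by
    rintro ⟨m, hm⟩
    rw [← F.exact_zero] at hm
    obtain ⟨f, hf⟩ := hm
    exact ⟨f, Subtype.ext hf⟩
  exact_zero := by rw [LinearMap.ker_codRestrict]; exact F.exact_succ 0
  exact_succ i := F.exact_succ (i + 1)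
  aug_homog l l' := F.d_homog 0 l l'
  d_homog i := F.d_homog (i + 1)

theorem GradedFreeRes.kReg {o : σ → ℕ} (ho : Function.Injective o) (N : ℕ) :
    ∀ {M : Type} [AddCommGroup M] [Module (MvPolynomial σ k) M] {gr : ℤ → AddSubgroup M}
      (_ : GradedData k (σ := σ) gr) (F : GradedFreeRes k σ M gr) (_ : ∀ i, N ≤ i → F.rk i = 0)
      {ρ : ℤ} (_ : ∀ i l, F.tw i l ≤ ρ + i), KReg k o gr ρ := by
  induction N with
  | zero =>
    intro M _ _ gr G F hN ρ _
    have : IsEmpty (Fin (F.rk 0)) := by rw [hN 0 le_rfl]; infer_instance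
    have hM : Subsingleton M := F.aug_surj.subsingleton
    exact fun u _ z _ _ => ⟨0, fun T => zero_mem _, Subsingleton.elim _ _⟩
  | succ N ih =>
    intro M _ _ gr G F hN ρ hρ
    refine KReg.of_ker G F.aug_homog ho F.aug_surj (fun l => by simpa using hρ 0 l) ?_
    refine ih (kerGradedData G F.aug_homog) F.tail (fun i hi => hN _ (by omega)) fun i l => ?_
    have := hρ (i + 1) l
    push_cast at this
    rw [add_assoc, add_comm 1]
    exact this

/-- `v` is a family of homogeneous generators of degrees `tw`. -/
def IsHomogeneousGenerators (gr : ℤ → AddSubgroup M) {g : ℕ} (v : Fin g → M) (tw : Fin g → ℤ) :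
    Prop :=
  (∀ l, v l ∈ gr (tw l)) ∧ Submodule.span (MvPolynomial σ k) (Set.range v) = ⊤

theorem GradedData.exists_generators {gr : ℤ → AddSubgroup M} (G : GradedData k (σ := σ) gr)
    [Module.Finite (MvPolynomial σ k) M] :
    ∃ (g : ℕ) (v : Fin g → M) (tw : Fin g → ℤ),
      IsHomogeneousGenerators (k := k) (σ := σ) gr v tw := by
  have h := Module.Finite.fg_top (R := MvPolynomial σ k) (M := M)
  rw [← G.span_homogeneous, Submodule.fg_span_iff_fg_span_finset_subset] at h
  obtain ⟨s, hs, hspan⟩ := h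
  have hs' : ∀ l, ∃ t, ((s.equivFin.symm l : s) : M) ∈ gr t := fun l => hs (s.equivFin.symm l).2
  choose tw htw using hs'
  refine ⟨s.card, fun l => (s.equivFin.symm l : s), tw, htw, ?_⟩
  rw [← G.span_homogeneous, hspan]
  congr 1
  ext m
  constructor
  · rintro ⟨l, rfl⟩
    exact (s.equivFin.symm l).2
  · intro hm
    exact ⟨s.equivFin ⟨m, hm⟩, by simp⟩

theorem GradedData.exists_minimal_generators {gr : ℤ → AddSubgroup M}
    (G : GradedData k (σ := σ) gr) [Module.Finite (MvPolynomial σ k) M] :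
    ∃ (g : ℕ) (tw : Fin g → ℤ) (φ : (Fin g → MvPolynomial σ k) →ₗ[MvPolynomial σ k] M),
      (∀ l, φ (Pi.single l 1) ∈ gr (tw l)) ∧ Function.Surjective φ ∧
        ∀ f, φ f = 0 → ∀ l, coeff 0 (f l) = 0 := by
  classical
  have hex := G.exists_generators
  obtain ⟨v, tw, hv, hspan⟩ := Nat.find_spec hex
  have hmin := fun g => Nat.find_min hex (m := g)
  revert v tw hmin
  generalize Nat.find hex = g
  intro v tw hv hspan hmin
  set φ := Fintype.linearCombination (MvPolynomial σ k) v with hφdef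
  have hφ (l : Fin g) : φ (Pi.single l 1) = v l := by
    rw [hφdef, Fintype.linearCombination_apply_single, one_smul]
  have hφ' : ∀ l, φ (Pi.single l 1) ∈ gr (tw l) := fun l => by rw [hφ]; exact hv l
  refine ⟨g, tw, φ, hφ', ?_, ?_⟩
  · rw [← LinearMap.range_eq_top, hφdef, Fintype.range_linearCombination, hspan]
  · intro f hf l₀
    by_contra hne
    cases g with
    | zero => exact l₀.elim0
    | succ g =>
    refine hmin g (by omega) ⟨v ∘ l₀.succAbove, tw ∘ l₀.succAbove, fun l => hv _, ?_⟩
    have hf' : φ ((freeGradedData tw).comp (tw l₀) f) = 0 := by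
      rw [aug_comp G φ hφ', hf, map_zero]
    set f' := (freeGradedData tw).comp (tw l₀) f with hf'def
    have h0 : f' l₀ = C (coeff 0 (f l₀)) := by
      ext a
      change coeff a (compZ (tw l₀ - tw l₀) (f l₀)) = _
      rw [coeff_compZ, coeff_C, sub_self]
      by_cases ha : a = 0
      · subst ha; simp
      · rw [if_neg (by simpa [Finsupp.degree_eq_zero_iff] using ha), if_neg (Ne.symm ha)]
    rw [hφdef, Fintype.linearCombination_apply, Fin.sum_univ_succAbove _ l₀, h0] at hf'
    have hmem : v l₀ ∈ Submodule.span (MvPolynomial σ k) (Set.range (v ∘ l₀.succAbove)) := by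
      have h1 : v l₀ = (C (coeff 0 (f l₀))⁻¹ : MvPolynomial σ k) •
          -(∑ i, f' (l₀.succAbove i) • v (l₀.succAbove i)) := by
        rw [← eq_neg_of_add_eq_zero_left hf', smul_smul, ← C_mul, inv_mul_cancel₀ hne, C_1,
          one_smul]
      rw [h1]
      refine Submodule.smul_mem _ _ (Submodule.neg_mem _ (Submodule.sum_mem _ fun i _ => ?_))
      exact Submodule.smul_mem _ _ (Submodule.subset_span ⟨i, rfl⟩)
    rw [← top_le_iff, ← hspan, Submodule.span_le]
    rintro _ ⟨l, rfl⟩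
    by_cases hl : l = l₀
    · rw [hl]; exact hmem
    · obtain ⟨i, rfl⟩ := Fin.exists_succAbove_eq hl
      exact Submodule.subset_span ⟨i, rfl⟩

theorem KReg.tw_le {gr : ℤ → AddSubgroup M} {g : ℕ} {tw : Fin g → ℤ}
    {φ : (Fin g → MvPolynomial σ k) →ₗ[MvPolynomial σ k] M}
    (hφ : ∀ l, φ (Pi.single l 1) ∈ gr (tw l)) (hs : Function.Surjective φ)
    (hmin : ∀ f, φ f = 0 → ∀ l, coeff 0 (f l) = 0) {o : σ → ℕ} {ρ : ℤ} (hρ : KReg k o gr ρ)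
    (l : Fin g) : tw l ≤ ρ := by
  by_contra! hlt
  obtain ⟨w, -, hw⟩ := hρ (tw l) hlt (fun T => if T = ∅ then φ (Pi.single l 1) else 0)
    (fun T => by split_ifs; exacts [hφ l, zero_mem _]) (kd_single_empty _)
  have h1 := congrFun hw ∅
  rw [if_pos rfl, kd_apply_empty] at h1
  choose f hf using fun i => hs (w {i})
  have h2 := hmin (∑ i, (X i : MvPolynomial σ k) • f i - Pi.single l 1) (by
    rw [map_sub, map_sum, ← h1, sub_eq_zero]
    exact Finset.sum_congr rfl fun i _ => by rw [map_smul, hf]) l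
  rw [Pi.sub_apply, Pi.single_eq_same, Finset.sum_apply, coeff_sub, coeff_sum,
    Finset.sum_eq_zero, zero_sub, coeff_zero_one, neg_eq_zero] at h2
  · exact one_ne_zero h2
  · intro i _
    change coeff 0 (X i * f i l) = 0
    rw [← constantCoeff_eq, map_mul, constantCoeff_X, zero_mul]

theorem KVan.exists_gradedFreeRes {o : σ → ℕ} (ho : Function.Injective o) (c : ℕ) :
    ∀ {M : Type} [AddCommGroup M] [Module (MvPolynomial σ k) M] {gr : ℤ → AddSubgroup M}
      (_ : GradedData k (σ := σ) gr) [Module.Finite (MvPolynomial σ k) M] (_ : KVan k M o c),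
      ∃ F : GradedFreeRes k σ M gr, ∀ ρ, KReg k o gr ρ → ∀ i l, F.tw i l ≤ ρ + i := by
  induction c with
  | zero =>
    intro M _ _ gr G _ h
    have hM := G.subsingleton_of_kVan h
    refine ⟨{ rk := fun _ => 0, tw := fun _ l => l.elim0, bdd := ⟨0, fun _ _ => rfl⟩, aug := 0,
              d := fun _ => 0, aug_surj := fun m => ⟨0, Subsingleton.elim _ _⟩,
              exact_zero := Subsingleton.elim _ _, exact_succ := fun _ => Subsingleton.elim _ _,
              aug_homog := fun l => l.elim0, d_homog := fun _ l => l.elim0 },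
      fun _ _ _ l => l.elim0⟩
  | succ c ih =>
    intro M _ _ gr G _ h
    obtain ⟨g, tw, φ, hφ, hs, hmin⟩ := G.exists_minimal_generators
    obtain ⟨F, hF⟩ := ih (kerGradedData G hφ) (h.ker ho hs hmin)
    refine ⟨F.cons hφ hs, fun ρ hρ i => ?_⟩
    have htw := hρ.tw_le hφ hs hmin
    cases i with
    | zero =>
      intro l
      have := htw l
      rw [Nat.cast_zero, add_zero]
      exact this
    | succ i =>
      intro l
      have := hF (ρ + 1) (hρ.ker G hφ ho hs htw) i l
      push_cast
      rw [add_comm (i : ℤ), ← add_assoc]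
      exact this

theorem exists_gradedFreeRes {o : σ → ℕ} (ho : Function.Injective o) {gr : ℤ → AddSubgroup M}
    (G : GradedData k (σ := σ) gr) [Module.Finite (MvPolynomial σ k) M] :
    ∃ F : GradedFreeRes k σ M gr, ∀ ρ, KReg k o gr ρ → ∀ i l, F.tw i l ≤ ρ + i := by
  refine KVan.exists_gradedFreeRes ho (Fintype.card σ + 1) G fun z hz _ => ⟨0, ?_⟩
  rw [map_zero]
  funext T
  exact (hz T (Nat.lt_succ_of_le (Finset.card_le_univ T))).symm

theorem le_of_kReg {o : σ → ℕ} {gr : ℤ → AddSubgroup M} {t : ℤ} (hmin : ∀ s < t, gr s = ⊥)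
    (G : GradedData k (σ := σ) gr) [Nontrivial M] {ρ : ℤ} (hρ : KReg k o gr ρ) : t ≤ ρ := by
  obtain ⟨t', ht', hmin'⟩ := G.exists_minimal_degree
  have htt : t ≤ t' := by
    by_contra! h
    exact ht' (hmin t' h)
  by_contra! hlt
  refine ht' (eq_bot_iff.2 fun m hm => ?_)
  obtain ⟨w, hw, hwz⟩ := hρ t' (by omega) (fun T => if T = ∅ then m else 0)
    (fun T => by split_ifs; exacts [hm, zero_mem _]) (kd_single_empty _)
  have hw0 : w = 0 := by
    funext T
    have := hw T
    rwa [hmin' _ (by omega), AddSubgroup.mem_bot] at this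
  have := congrFun hwz ∅
  rw [hw0, map_zero, if_pos rfl] at this
  exact this.symm

theorem regM_le_iff {o : σ → ℕ} (ho : Function.Injective o) {gr : ℤ → AddSubgroup M}
    (G : GradedData k (σ := σ) gr) [Module.Finite (MvPolynomial σ k) M] [Nontrivial M] {ρ : ℤ} :
    regM k σ M gr ≤ ρ ↔ KReg k o gr ρ := by
  have hset : {r : ℤ | ∃ F : GradedFreeRes k σ M gr,
      ∀ i (l : Fin (F.rk i)), F.tw i l - (i : ℤ) ≤ r} = {r | KReg k o gr r} := by
    ext r
    constructor
    · rintro ⟨F, hF⟩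
      obtain ⟨N, hN⟩ := F.bdd
      exact F.kReg ho N G hN fun i l => by linarith [hF i l]
    · intro hr
      obtain ⟨F, hF⟩ := exists_gradedFreeRes ho G
      exact ⟨F, fun i l => by linarith [hF r hr i l]⟩
  have hne : {r : ℤ | KReg k o gr r}.Nonempty := by
    rw [← hset]
    obtain ⟨F, -⟩ := exists_gradedFreeRes ho G
    obtain ⟨N, hN⟩ := F.bdd
    have hfin : (Set.range fun x : Σ i : Fin N, Fin (F.rk i) => F.tw x.1 x.2 - (x.1 : ℤ)).Finite :=
      Set.finite_range _
    obtain ⟨b, hb⟩ := hfin.bddAbove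
    refine ⟨b, F, fun i l => ?_⟩
    have hi : i < N := by
      by_contra hi
      have := hN i (by omega)
      exact (this ▸ l).elim0
    exact hb ⟨⟨⟨i, hi⟩, l⟩, rfl⟩
  have hbdd : BddBelow {r : ℤ | KReg k o gr r} := by
    obtain ⟨t, -, hmin⟩ := G.exists_minimal_degree
    exact ⟨t, fun r hr => le_of_kReg hmin G hr⟩
  rw [regM, hset]
  constructor
  · intro h u hu
    exact (Int.csInf_mem hne hbdd) u (by omega)
  · intro h
    exact csInf_le hbdd h

end Resolutions

section Ideals

variable {k : Type} [Field k] {σ : Type}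

theorem IsHomogeneousIdeal.compZ_mem {X : Ideal (MvPolynomial σ k)} (hX : IsHomogeneousIdeal k X)
    {f : MvPolynomial σ k} (hf : f ∈ X) (t : ℤ) : compZ t f ∈ X := by
  unfold compZ
  split_ifs
  · exact hX f hf _
  · exact X.zero_mem

theorem isHomogeneousIdeal_of_compZ_mem {X : Ideal (MvPolynomial σ k)}
    (h : ∀ f ∈ X, ∀ t : ℤ, compZ t f ∈ X) : IsHomogeneousIdeal k X := by
  intro f hf m
  have := h f hf m
  simpa [compZ] using this

theorem compZ_mul_mem {X : Ideal (MvPolynomial σ k)} {g : MvPolynomial σ k}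
    (hg : ∀ t, compZ t g ∈ X) (f : MvPolynomial σ k) (t : ℤ) : compZ t (f * g) ∈ X := by
  rw [sum_compZ f, Finset.sum_mul, map_sum]
  refine X.sum_mem fun i _ => ?_
  rw [compZ_mul_left (homogZ_compZ (i : ℤ) f)]
  exact X.mul_mem_left _ (hg _)

theorem isHomogeneousIdeal_span {s : Set (MvPolynomial σ k)}
    (h : ∀ f ∈ s, ∀ t, compZ t f ∈ Ideal.span s) : IsHomogeneousIdeal k (Ideal.span s) := by
  refine isHomogeneousIdeal_of_compZ_mem fun f hf => ?_
  induction hf using Submodule.span_induction with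
  | mem f hf => exact h f hf
  | zero => intro t; rw [map_zero]; exact zero_mem _
  | add f g _ _ hf hg => intro t; rw [map_add]; exact add_mem (hf t) (hg t)
  | smul a f _ hf => intro t; exact compZ_mul_mem hf a t

theorem isHomogeneousIdeal_top : IsHomogeneousIdeal k (⊤ : Ideal (MvPolynomial σ k)) :=
  fun _ _ _ => Submodule.mem_top

theorem IsHomogeneousIdeal.sup {X Y : Ideal (MvPolynomial σ k)} (hX : IsHomogeneousIdeal k X)
    (hY : IsHomogeneousIdeal k Y) : IsHomogeneousIdeal k (X ⊔ Y) := by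
  refine isHomogeneousIdeal_of_compZ_mem fun f hf t => ?_
  obtain ⟨x, hx, y, hy, rfl⟩ := Submodule.mem_sup.1 hf
  rw [map_add]
  exact Submodule.add_mem_sup (hX.compZ_mem hx t) (hY.compZ_mem hy t)

theorem IsHomogeneousIdeal.inf {X Y : Ideal (MvPolynomial σ k)} (hX : IsHomogeneousIdeal k X)
    (hY : IsHomogeneousIdeal k Y) : IsHomogeneousIdeal k (X ⊓ Y) :=
  fun f hf m => ⟨hX f hf.1 m, hY f hf.2 m⟩

theorem IsHomogeneousIdeal.mul {X Y : Ideal (MvPolynomial σ k)} (hX : IsHomogeneousIdeal k X)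
    (hY : IsHomogeneousIdeal k Y) : IsHomogeneousIdeal k (X * Y) := by
  refine isHomogeneousIdeal_of_compZ_mem fun f hf t => ?_
  induction hf using Submodule.mul_induction_on' with
  | mem_mul_mem x hx y hy =>
    rw [sum_compZ x, Finset.sum_mul, map_sum]
    refine (X * Y).sum_mem fun i _ => ?_
    rw [compZ_mul_left (homogZ_compZ (i : ℤ) x)]
    exact Ideal.mul_mem_mul (hX.compZ_mem hx _) (hY.compZ_mem hy _)
  | add x _ y _ hx hy => rw [map_add]; exact add_mem hx hy

theorem IsHomogeneousIdeal.pow {X : Ideal (MvPolynomial σ k)} (hX : IsHomogeneousIdeal k X)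
    (n : ℕ) : IsHomogeneousIdeal k (X ^ n) := by
  induction n with
  | zero => rw [pow_zero, Ideal.one_eq_top]; exact isHomogeneousIdeal_top
  | succ n ih => rw [pow_succ]; exact ih.mul hX

theorem compZ_rename {τ : Type} {f : σ → τ} (hf : Function.Injective f) (t : ℤ)
    (p : MvPolynomial σ k) : compZ t (rename f p) = rename f (compZ t p) := by
  ext a
  rw [coeff_compZ]
  by_cases ha : ∃ b, a = Finsupp.mapDomain f b
  · obtain ⟨b, rfl⟩ := ha
    rw [coeff_rename_mapDomain _ hf, coeff_rename_mapDomain _ hf, coeff_compZ,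
      Finsupp.degree_mapDomain]
  · rw [coeff_rename_eq_zero _ _ _ fun b hb => absurd ⟨b, hb.symm⟩ ha,
      coeff_rename_eq_zero _ _ _ fun b hb => absurd ⟨b, hb.symm⟩ ha, ite_self]

theorem IsHomogeneousIdeal.map_rename {τ : Type} {f : σ → τ} (hf : Function.Injective f)
    {X : Ideal (MvPolynomial σ k)} (hX : IsHomogeneousIdeal k X) :
    IsHomogeneousIdeal k (X.map (rename f : MvPolynomial σ k →ₐ[k] MvPolynomial τ k)) := by
  refine isHomogeneousIdeal_span ?_
  rintro _ ⟨p, hp, rfl⟩ t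
  rw [compZ_rename hf]
  exact Ideal.subset_span ⟨_, hX.compZ_mem hp t, rfl⟩

theorem mem_idealGr_iff {X : Ideal (MvPolynomial σ k)} {t : ℤ} {x : X} :
    x ∈ idealGr k X t ↔ homogZ k (x : MvPolynomial σ k) t := by
  refine ⟨fun h => ?_, fun h => AddSubgroup.subset_closure h⟩
  unfold idealGr at h
  induction h using AddSubgroup.closure_induction with
  | mem x hx => exact hx
  | zero => exact homogZ_zero t
  | add x y _ _ hx hy => exact homogZ_add hx hy
  | neg x _ hx => exact homogZ_neg hx

/-- The graded pieces of a homogeneous ideal. -/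
def idealGradedData {X : Ideal (MvPolynomial σ k)} (hX : IsHomogeneousIdeal k X) :
    GradedData k (σ := σ) (idealGr k X) where
  comp t :=
    { toFun := fun x => ⟨compZ t x.1, hX.compZ_mem x.2 t⟩
      map_zero' := Subtype.ext (map_zero _)
      map_add' := fun x y => Subtype.ext (map_add _ _ _) }
  comp_mem t x := mem_idealGr_iff.2 (homogZ_compZ _ _)
  comp_self h := Subtype.ext (compZ_of_homogZ (mem_idealGr_iff.1 h))
  comp_ne h hs := Subtype.ext (compZ_of_ne (mem_idealGr_iff.1 h) hs)
  sum_comp x := by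
    refine ⟨(Finset.range (x.1.totalDegree + 1)).image (fun i : ℕ => (i : ℤ)), Subtype.ext ?_⟩
    rw [Finset.sum_image (by simp), AddSubmonoidClass.coe_finsetSum]
    exact sum_compZ x.1
  smul_mem {p d t m} hp hm := by
    rw [mem_idealGr_iff] at hm ⊢
    rw [add_comm]
    exact homogZ_mul hp hm
  bdd := by
    refine ⟨0, fun t ht => eq_bot_iff.2 fun x hx => ?_⟩
    rw [AddSubgroup.mem_bot]
    exact Subtype.ext (homogZ_neg_degree (mem_idealGr_iff.1 hx) ht)

variable [Fintype σ] [DecidableEq σ]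

/-- Every Koszul cycle of degree greater than `ρ` with coefficients in `X` is the boundary of a
chain with coefficients in `X`. -/
def IReg (k : Type) [Field k] {σ : Type} [Fintype σ] [DecidableEq σ] (o : σ → ℕ)
    (X : Ideal (MvPolynomial σ k)) (ρ : ℤ) : Prop :=
  ∀ u > ρ, ∀ z : Finset σ → MvPolynomial σ k, (∀ T, z T ∈ X) → (∀ T, homogZ k (z T) u) →
    kd (k := k) o z = 0 → ∃ w : Finset σ → MvPolynomial σ k, (∀ T, w T ∈ X) ∧ kd (k := k) o w = z

theorem compZ_kd (o : σ → ℕ) (t : ℤ) (z : Finset σ → MvPolynomial σ k) (T : Finset σ) :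
    compZ t (kd (k := k) o z T) = kd (k := k) o (fun T => compZ (t - 1) (z T)) T := by
  simp only [kd_apply, map_sum, map_zsmul, smul_eq_mul, compZ_mul_left (homogZ_X _)]

theorem homogZ_kd (o : σ → ℕ) {t : ℤ} {z : Finset σ → MvPolynomial σ k}
    (hz : ∀ T, homogZ k (z T) t) (T : Finset σ) : homogZ k (kd (k := k) o z T) (t + 1) := by
  have h : z = fun T => compZ (t + 1 - 1) (z T) := by
    funext T
    rw [compZ_of_homogZ]
    rw [add_sub_cancel_right]
    exact hz T
  rw [h, ← compZ_kd]
  exact homogZ_compZ _ _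

theorem IReg.exists_homogZ {o : σ → ℕ} {X : Ideal (MvPolynomial σ k)}
    (hX : IsHomogeneousIdeal k X) {ρ : ℤ} (h : IReg k o X ρ) {u : ℤ} (hu : ρ < u)
    {z : Finset σ → MvPolynomial σ k} (hzX : ∀ T, z T ∈ X) (hz : ∀ T, homogZ k (z T) u)
    (hd : kd (k := k) o z = 0) :
    ∃ w : Finset σ → MvPolynomial σ k, (∀ T, w T ∈ X) ∧ (∀ T, homogZ k (w T) (u - 1)) ∧
      kd (k := k) o w = z := by
  obtain ⟨w, hwX, hw⟩ := h u hu z hzX hz hd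
  refine ⟨fun T => compZ (u - 1) (w T), fun T => hX.compZ_mem (hwX T) _,
    fun T => homogZ_compZ _ _, ?_⟩
  funext T
  rw [← compZ_kd, hw, compZ_of_homogZ (hz T)]

theorem kd_coe_ideal (o : σ → ℕ) {X : Ideal (MvPolynomial σ k)} (z : Finset σ → X) :
    (fun T => ((kd (k := k) o z T : X) : MvPolynomial σ k)) =
      kd (k := k) o (fun T => (z T : MvPolynomial σ k)) :=
  (kd_comp o X.subtype z).symm

theorem kReg_ideal_iff {o : σ → ℕ} {X : Ideal (MvPolynomial σ k)} (hX : IsHomogeneousIdeal k X)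
    {ρ : ℤ} : KReg k o (idealGr k X) ρ ↔ IReg k o X ρ := by
  constructor
  · intro h u hu z hzX hz hd
    obtain ⟨w, -, hw⟩ := h u hu (fun T => ⟨z T, hzX T⟩) (fun T => mem_idealGr_iff.2 (hz T)) (by
      funext T
      refine Subtype.ext ((congrFun (kd_coe_ideal o _) T).trans ?_)
      exact congrFun hd T)
    refine ⟨fun T => w T, fun T => (w T).2, ?_⟩
    rw [← kd_coe_ideal, hw]
  · intro h u hu z hz hd
    obtain ⟨w, hwX, hwu, hw⟩ := h.exists_homogZ hX hu (z := fun T => (z T : MvPolynomial σ k))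
      (fun T => (z T).2) (fun T => mem_idealGr_iff.1 (hz T)) (by
        rw [← kd_coe_ideal, hd]; rfl)
    refine ⟨fun T => ⟨w T, hwX T⟩, fun T => mem_idealGr_iff.2 (hwu T), ?_⟩
    funext T
    exact Subtype.ext ((congrFun (kd_coe_ideal o _) T).trans (congrFun hw T))

theorem regIdeal_le_iff {o : σ → ℕ} (ho : Function.Injective o) {X : Ideal (MvPolynomial σ k)}
    (hX : IsHomogeneousIdeal k X) (hX0 : X ≠ ⊥) {ρ : ℤ} : regIdeal k X ≤ ρ ↔ IReg k o X ρ := by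
  have : Nontrivial X := Submodule.nontrivial_iff_ne_bot.2 hX0
  rw [← kReg_ideal_iff hX]
  exact regM_le_iff ho (idealGradedData hX)

theorem le_regIdeal {o : σ → ℕ} (ho : Function.Injective o) {X : Ideal (MvPolynomial σ k)}
    (hX : IsHomogeneousIdeal k X) (hX0 : X ≠ ⊥) {t : ℤ}
    (h : ∀ f ∈ X, ∀ s < t, homogZ k f s → f = 0) : t ≤ regIdeal k X := by
  have : Nontrivial X := Submodule.nontrivial_iff_ne_bot.2 hX0
  refine le_of_kReg (o := o) (fun s hs => ?_) (idealGradedData hX)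
    ((kReg_ideal_iff hX).2 ((regIdeal_le_iff ho hX hX0).1 le_rfl))
  rw [eq_bot_iff]
  intro x hx
  rw [AddSubgroup.mem_bot]
  exact Subtype.ext (h x x.2 s hs (mem_idealGr_iff.1 hx))

theorem regIdeal_top {o : σ → ℕ} (ho : Function.Injective o) :
    regIdeal k (⊤ : Ideal (MvPolynomial σ k)) = 0 := by
  have h0 : (⊤ : Ideal (MvPolynomial σ k)) ≠ ⊥ := top_ne_bot
  refine le_antisymm ?_ ?_
  · rw [regIdeal_le_iff ho isHomogeneousIdeal_top h0]
    intro u hu z _ hz hd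
    refine ⟨koszulHomotopy o z, fun _ => Submodule.mem_top, kd_koszulHomotopy ho ?_ hd⟩
    by_contra hne
    have := homogZ_iff.1 (hz ∅) 0 hne
    simp at this
    omega
  · exact le_regIdeal ho isHomogeneousIdeal_top h0 fun f _ s hs hf => homogZ_neg_degree hf hs

theorem exists_homogZ_of_mem_sup {X Y : Ideal (MvPolynomial σ k)} (hX : IsHomogeneousIdeal k X)
    (hY : IsHomogeneousIdeal k Y) {u : ℤ} {f : MvPolynomial σ k} (hf : f ∈ X ⊔ Y)
    (hu : homogZ k f u) :
    ∃ x ∈ X, ∃ y ∈ Y, homogZ k x u ∧ homogZ k y u ∧ x + y = f := by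
  obtain ⟨x, hx, y, hy, rfl⟩ := Submodule.mem_sup.1 hf
  exact ⟨_, hX.compZ_mem hx u, _, hY.compZ_mem hy u, homogZ_compZ _ _, homogZ_compZ _ _, by
    rw [← map_add, compZ_of_homogZ hu]⟩

theorem homogZ_sub {p q : MvPolynomial σ k} {t : ℤ} (hp : homogZ k p t) (hq : homogZ k q t) :
    homogZ k (p - q) t := by
  rw [sub_eq_add_neg]
  exact homogZ_add hp (homogZ_neg hq)

theorem IReg.sup {o : σ → ℕ} (ho : Function.Injective o) {X Y : Ideal (MvPolynomial σ k)}
    (hX : IsHomogeneousIdeal k X) (hY : IsHomogeneousIdeal k Y) {ρ : ℤ} (hXρ : IReg k o X ρ)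
    (hYρ : IReg k o Y ρ) (hXY : IReg k o (X ⊓ Y) (ρ + 1)) : IReg k o (X ⊔ Y) ρ := by
  intro u hu z hzXY hz hd
  choose x hx y hy hxu hyu hxy using fun T => exists_homogZ_of_mem_sup hX hY (hzXY T) (hz T)
  have hz' : z = x + y := funext fun T => (hxy T).symm
  have hxy' : kd (k := k) o x = kd (k := k) o (-y) := by
    rw [hz', map_add] at hd
    rw [map_neg]
    exact eq_neg_of_add_eq_zero_left hd
  obtain ⟨v, hv, hvu, hvx⟩ := hXY.exists_homogZ (hX.inf hY) (u := u + 1) (by omega)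
    (z := kd (k := k) o x) (fun T => ⟨kd_mem o hx T, by
      rw [hxy']
      exact kd_mem (N := Y) o (fun T => Y.neg_mem (hy T)) T⟩) (homogZ_kd o hxu) (kd_kd ho x)
  rw [add_sub_cancel_right] at hvu
  obtain ⟨a, ha, haz⟩ := hXρ u hu (x - v) (fun T => X.sub_mem (hx T) (hv T).1)
    (fun T => homogZ_sub (hxu T) (hvu T)) (by rw [map_sub, hvx, sub_self])
  obtain ⟨b, hb, hbz⟩ := hYρ u hu (y + v) (fun T => Y.add_mem (hy T) (hv T).2)
    (fun T => homogZ_add (hyu T) (hvu T)) (by rw [map_add, hvx, hxy', map_neg, add_neg_cancel])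
  refine ⟨a + b, fun T => Submodule.add_mem_sup (ha T) (hb T), ?_⟩
  rw [map_add, haz, hbz, hz']
  abel

theorem IReg.inf {o : σ → ℕ} (ho : Function.Injective o) {X Y : Ideal (MvPolynomial σ k)}
    (hX : IsHomogeneousIdeal k X) (hY : IsHomogeneousIdeal k Y) {ρ : ℤ} (hXρ : IReg k o X ρ)
    (hYρ : IReg k o Y ρ) (hXY : IReg k o (X ⊔ Y) (ρ - 1)) : IReg k o (X ⊓ Y) ρ := by
  intro u hu z hzXY hz hd
  obtain ⟨x, hx, hxu, hxz⟩ := hXρ.exists_homogZ hX hu (fun T => (hzXY T).1) hz hd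
  obtain ⟨y, hy, hyu, hyz⟩ := hYρ.exists_homogZ hY hu (fun T => (hzXY T).2) hz hd
  obtain ⟨v, hv, hvxy⟩ := hXY (u - 1) (by omega) (x - y)
    (fun T => Submodule.sub_mem _ (Submodule.mem_sup_left (hx T)) (Submodule.mem_sup_right (hy T)))
    (fun T => homogZ_sub (hxu T) (hyu T)) (by rw [map_sub, hxz, hyz, sub_self])
  choose a ha b hb hab using fun T => Submodule.mem_sup.1 (hv T)
  have hv' : v = a + b := funext fun T => (hab T).symm
  have key : x - kd (k := k) o a = y + kd (k := k) o b := by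
    rw [hv', map_add] at hvxy
    rw [sub_eq_iff_eq_add, add_assoc, add_comm (kd (k := k) o b), hvxy]
    abel
  refine ⟨x - kd (k := k) o a, fun T => ⟨X.sub_mem (hx T) (kd_mem o ha T), ?_⟩, ?_⟩
  · rw [key]
    exact Y.add_mem (hy T) (kd_mem o hb T)
  · rw [map_sub, kd_kd ho, sub_zero, hxz]

theorem regIdeal_sup_le {o : σ → ℕ} (ho : Function.Injective o) {X Y : Ideal (MvPolynomial σ k)}
    (hX : IsHomogeneousIdeal k X) (hY : IsHomogeneousIdeal k Y) (h0 : X ⊓ Y ≠ ⊥) {ρ : ℤ}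
    (hXρ : regIdeal k X ≤ ρ) (hYρ : regIdeal k Y ≤ ρ) (hXY : regIdeal k (X ⊓ Y) ≤ ρ + 1) :
    regIdeal k (X ⊔ Y) ≤ ρ := by
  have hX0 : X ≠ ⊥ := fun h => h0 (by rw [h, bot_inf_eq])
  have hY0 : Y ≠ ⊥ := fun h => h0 (by rw [h, inf_bot_eq])
  rw [regIdeal_le_iff ho hX hX0] at hXρ
  rw [regIdeal_le_iff ho hY hY0] at hYρ
  rw [regIdeal_le_iff ho (hX.inf hY) h0] at hXY
  rw [regIdeal_le_iff ho (hX.sup hY) fun h => hX0 (sup_eq_bot_iff.1 h).1]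
  exact hXρ.sup ho hX hY hYρ hXY

theorem regIdeal_inf_le {o : σ → ℕ} (ho : Function.Injective o) {X Y : Ideal (MvPolynomial σ k)}
    (hX : IsHomogeneousIdeal k X) (hY : IsHomogeneousIdeal k Y) (h0 : X ⊓ Y ≠ ⊥) {ρ : ℤ}
    (hXρ : regIdeal k X ≤ ρ) (hYρ : regIdeal k Y ≤ ρ) (hXY : regIdeal k (X ⊔ Y) ≤ ρ - 1) :
    regIdeal k (X ⊓ Y) ≤ ρ := by
  have hX0 : X ≠ ⊥ := fun h => h0 (by rw [h, bot_inf_eq])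
  have hY0 : Y ≠ ⊥ := fun h => h0 (by rw [h, inf_bot_eq])
  rw [regIdeal_le_iff ho hX hX0] at hXρ
  rw [regIdeal_le_iff ho hY hY0] at hYρ
  rw [regIdeal_le_iff ho (hX.sup hY) fun h => hX0 (sup_eq_bot_iff.1 h).1] at hXY
  rw [regIdeal_le_iff ho (hX.inf hY) h0]
  exact hXρ.inf ho hX hY hYρ hXY

theorem IsHomogeneousIdeal.le_idealOfVars {X : Ideal (MvPolynomial σ k)}
    (hX : IsHomogeneousIdeal k X) (h1 : X ≠ ⊤) : X ≤ idealOfVars σ k := by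
  intro f hf
  rw [← pow_one (idealOfVars σ k), mem_pow_idealOfVars_iff']
  intro a ha
  have ha0 : a = 0 := by
    rw [← Finsupp.degree_eq_zero_iff]
    omega
  subst ha0
  by_contra hne
  refine h1 ((Ideal.eq_top_iff_one X).2 ?_)
  have h2 := X.mul_mem_left (C (coeff 0 f)⁻¹) (hX.compZ_mem hf 0)
  have h3 : compZ 0 f = C (coeff 0 f) := by
    ext a
    rw [coeff_compZ, coeff_C]
    by_cases ha : a = 0
    · subst ha; simp
    · rw [if_neg (by simpa [Finsupp.degree_eq_zero_iff] using ha), if_neg (Ne.symm ha)]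
  rwa [h3, ← C_mul, inv_mul_cancel₀ hne, C_1] at h2

theorem le_regIdeal_pow {o : σ → ℕ} (ho : Function.Injective o) {X : Ideal (MvPolynomial σ k)}
    (hX : IsHomogeneousIdeal k X) (h0 : X ≠ ⊥) (h1 : X ≠ ⊤) (n : ℕ) : n ≤ regIdeal k (X ^ n) := by
  refine le_regIdeal ho (hX.pow n) (pow_ne_zero n h0) fun f hf s hs hfs => ?_
  have h2 := Ideal.pow_right_mono (hX.le_idealOfVars h1) n hf
  rw [mem_pow_idealOfVars_iff'] at h2
  ext a
  rw [coeff_zero]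
  by_contra hne
  have h3 := homogZ_iff.1 hfs a hne
  exact hne (h2 a (by omega))

end Ideals

section LinearAlgebra

open TensorProduct

variable {k : Type} [Field k] {V W : Type} [AddCommGroup V] [Module k V] [AddCommGroup W]
  [Module k W]

theorem exists_projection (B Y : Submodule k V) :
    ∃ P : V →ₗ[k] V, (∀ b ∈ B, P b = b) ∧ ∀ z ∈ B ⊔ Y, P z ∈ B ∧ z - P z ∈ Y := by
  obtain ⟨Y', hY'⟩ := Submodule.exists_isCompl ((B ⊓ Y).comap Y.subtype)
  have hdisj : Disjoint (Y'.map Y.subtype) B := by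
    rw [Submodule.disjoint_def]
    rintro _ ⟨y, hy, rfl⟩ hyB
    have : y = 0 := (Submodule.disjoint_def.1 hY'.disjoint) y ⟨hyB, y.2⟩ hy
    rw [this, map_zero]
  obtain ⟨Q, hQ, hc⟩ := hdisj.exists_isCompl
  refine ⟨B.subtype ∘ₗ Submodule.projectionOnto B Q hc.symm, fun b hb => ?_, fun z hz => ?_⟩
  · exact congrArg Subtype.val (Submodule.projectionOnto_apply_left hc.symm ⟨b, hb⟩)
  · refine ⟨Subtype.mem _, ?_⟩
    obtain ⟨b, hb, y, hy, rfl⟩ := Submodule.mem_sup.1 hz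
    obtain ⟨y₁, hy₁, y₂, hy₂, hyy⟩ := Submodule.mem_sup.1
      (hY'.sup_eq_top ▸ Submodule.mem_top : (⟨y, hy⟩ : Y) ∈ (B ⊓ Y).comap Y.subtype ⊔ Y')
    have hyy' : (y₁ : V) + y₂ = y := congrArg Subtype.val hyy
    have hP : (B.subtype ∘ₗ Submodule.projectionOnto B Q hc.symm) (b + y) = b + y₁ := by
      rw [← hyy', ← add_assoc, map_add]
      have h1 := Submodule.projectionOnto_apply_left hc.symm ⟨b + y₁, B.add_mem hb hy₁.1⟩
      have h2 := Submodule.projectionOnto_apply_right hc.symm ⟨y₂, hQ ⟨y₂, hy₂, rfl⟩⟩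
      simp only [LinearMap.comp_apply] at h1 h2 ⊢
      rw [h1, h2, map_zero, add_zero]
      rfl
    rw [hP, ← hyy', show b + ((y₁ : V) + y₂) - (b + y₁) = y₂ by abel]
    exact y₂.2

theorem exists_homotopy (d : Module.End k V) (hd : d * d = 0) (Y : Submodule k V)
    (hZ : LinearMap.ker d ≤ LinearMap.range d ⊔ Y) :
    ∃ h π : Module.End k V, d * h + h * d = 1 - π ∧ ∀ x, π x ∈ Y := by
  have hdd (x : V) : d (d x) = 0 := LinearMap.congr_fun hd x
  obtain ⟨P, hPB, hPZ⟩ := exists_projection (LinearMap.range d) Y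
  obtain ⟨s₀, hs₀⟩ := d.rangeRestrict.exists_rightInverse_of_surjective d.range_rangeRestrict
  obtain ⟨s, hs⟩ := s₀.exists_extend
  have hds (y : V) (hy : y ∈ LinearMap.range d) : d (s y) = y := by
    have h1 : s y = s₀ ⟨y, hy⟩ := LinearMap.congr_fun hs ⟨y, hy⟩
    have h2 := congrArg Subtype.val (LinearMap.congr_fun hs₀ ⟨y, hy⟩)
    rw [h1]
    exact h2
  have hker (x : V) : x - s (d x) ∈ LinearMap.range d ⊔ Y :=
    hZ (by rw [LinearMap.mem_ker, map_sub, hds _ ⟨x, rfl⟩, sub_self])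
  refine ⟨s ∘ₗ P ∘ₗ (LinearMap.id - s ∘ₗ d), (LinearMap.id - P) ∘ₗ (LinearMap.id - s ∘ₗ d), ?_,
    fun x => (hPZ _ (hker x)).2⟩
  ext x
  simp only [LinearMap.add_apply, Module.End.mul_apply, LinearMap.comp_apply, LinearMap.sub_apply,
    LinearMap.id_apply, Module.End.one_apply, hdd, map_zero, sub_zero]
  rw [hds _ (hPZ _ (hker x)).1, hPB _ ⟨x, rfl⟩]
  abel

theorem exists_odd_homotopy (d : Module.End k V) (hd : d * d = 0) (Y : Submodule k V)
    (hZ : LinearMap.ker d ≤ LinearMap.range d ⊔ Y)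
    (p : Module.End k V) (hp : p * p = p) (hdp : d * p = (1 - p) * d) (hpY : ∀ y ∈ Y, p y ∈ Y) :
    ∃ h π : Module.End k V, d * h + h * d = 1 - π ∧ (∀ x, π x ∈ Y) ∧
      (p - (1 - p)) * h = -(h * (p - (1 - p))) := by
  obtain ⟨h, π, hh, hπ⟩ := exists_homotopy d hd Y hZ
  obtain ⟨q, hq⟩ : ∃ q, q = 1 - p := ⟨_, rfl⟩
  have hpd : p * d = d * q := by
    rw [hq, mul_sub, hdp, sub_mul]; noncomm_ring
  rw [← hq] at hdp ⊢
  have hpq : p * q = 0 := by rw [hq, mul_sub, hp, mul_one, sub_self]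
  have hqp : q * p = 0 := by rw [hq, sub_mul, hp, one_mul, sub_self]
  have hqq : q * q = q := by rw [hq, mul_sub, mul_one, ← hq, hqp, sub_zero]
  have hone : (1 : Module.End k V) = p + q := by rw [hq]; abel
  have hqd : q * d = d * p := hdp.symm
  refine ⟨p * h * q + q * h * p, p * π * p + q * π * q, ?_, fun x => ?_, ?_⟩
  · have e1 : d * (p * h * q) = q * (d * h) * q := by
      rw [mul_assoc p, ← mul_assoc d, hdp]; simp only [mul_assoc]
    have e2 : d * (q * h * p) = p * (d * h) * p := by
      rw [mul_assoc q, ← mul_assoc d, ← hpd]; simp only [mul_assoc]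
    have e3 : p * h * q * d = p * (h * d) * p := by
      rw [mul_assoc (p * h), hqd]; simp only [mul_assoc]
    have e4 : q * h * p * d = q * (h * d) * q := by
      rw [mul_assoc (q * h), hpd]; simp only [mul_assoc]
    rw [mul_add, add_mul, e1, e2, e3, e4]
    have e5 : q * (d * h) * q + p * (d * h) * p + (p * (h * d) * p + q * (h * d) * q) =
        p * (d * h + h * d) * p + q * (d * h + h * d) * q := by noncomm_ring
    rw [e5, hh]
    have e6 : p * (1 - π) * p + q * (1 - π) * q = (p * p + q * q) - (p * π * p + q * π * q) := by
      noncomm_ring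
    rw [e6, hp, hqq, ← hone]
  · have hqY : ∀ y ∈ Y, q y ∈ Y := fun y hy => by
      rw [hq]; exact Y.sub_mem hy (hpY y hy)
    exact Y.add_mem (hpY _ (hπ _)) (hqY _ (hπ _))
  · have l1 : p * (p * h * q) = p * h * q := by rw [← mul_assoc, ← mul_assoc, hp]
    have l2 : p * (q * h * p) = 0 := by rw [← mul_assoc, ← mul_assoc, hpq, zero_mul, zero_mul]
    have l3 : q * (p * h * q) = 0 := by rw [← mul_assoc, ← mul_assoc, hqp, zero_mul, zero_mul]
    have l4 : q * (q * h * p) = q * h * p := by rw [← mul_assoc, ← mul_assoc, hqq]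
    have l5 : p * h * q * p = 0 := by rw [mul_assoc, hqp, mul_zero]
    have l6 : p * h * q * q = p * h * q := by rw [mul_assoc, hqq]
    have l7 : q * h * p * p = q * h * p := by rw [mul_assoc, hp]
    have l8 : q * h * p * q = 0 := by rw [mul_assoc, hpq, mul_zero]
    rw [sub_mul, mul_sub, mul_add, mul_add, add_mul, add_mul, l1, l2, l3, l4, l5, l6, l7, l8]
    abel

/-- The differential of the tensor product of two complexes, `ε` being the sign operator of the
first one. -/
def tensorD (dV ε : Module.End k V) (dW : Module.End k W) : Module.End k (V ⊗[k] W) :=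
  TensorProduct.map dV 1 + TensorProduct.map ε dW

theorem tensor_cycle_decomposition {dV ε h π : Module.End k V} {dW h' π' : Module.End k W}
    (hdV : dV * dV = 0) (hdW : dW * dW = 0) (hεε : ε * ε = 1) (hεd : ε * dV = -(dV * ε))
    (hh : dV * h + h * dV = 1 - π) (hεh : ε * h = -(h * ε)) (hπ : dV * π = 0)
    (hh' : dW * h' + h' * dW = 1 - π') {z : V ⊗[k] W} (hz : tensorD dV ε dW z = 0) :
    ∃ w, z = tensorD dV ε dW w + TensorProduct.map π π' z := by
  have key1 : tensorD dV ε dW * TensorProduct.map h 1 + TensorProduct.map h 1 * tensorD dV ε dW =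
      1 - TensorProduct.map π 1 := by
    rw [eq_sub_iff_add_eq]
    unfold tensorD
    ext v w
    have e1 := LinearMap.congr_fun hh v
    have e2 := LinearMap.congr_fun hεh v
    simp only [LinearMap.add_apply, Module.End.mul_apply, LinearMap.sub_apply,
      LinearMap.neg_apply, Module.End.one_apply] at e1 e2
    simp only [AlgebraTensorModule.curry_apply, LinearMap.restrictScalars_self, curry_apply,
      LinearMap.add_apply, Module.End.mul_apply, TensorProduct.map_tmul, map_add,
      Module.End.one_apply, e2]
    rw [show v ⊗ₜ[k] w = (dV (h v) + h (dV v) + π v) ⊗ₜ[k] w by rw [e1, sub_add_cancel]]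
    simp only [TensorProduct.add_tmul, TensorProduct.neg_tmul]
    abel
  have key2 : tensorD dV ε dW * tensorD dV ε dW = 0 := by
    unfold tensorD
    ext v w
    have e1 := LinearMap.congr_fun hdV v
    have e2 := LinearMap.congr_fun hdW w
    have e3 := LinearMap.congr_fun hεd v
    simp only [Module.End.mul_apply, LinearMap.zero_apply, LinearMap.neg_apply] at e1 e2 e3
    simp only [AlgebraTensorModule.curry_apply, LinearMap.restrictScalars_self, curry_apply,
      LinearMap.add_apply, Module.End.mul_apply, TensorProduct.map_tmul, map_add,
      Module.End.one_apply, LinearMap.zero_apply, e1, e2, e3]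
    simp only [TensorProduct.zero_tmul, TensorProduct.tmul_zero, TensorProduct.neg_tmul]
    abel
  have hz1 : z = tensorD dV ε dW (TensorProduct.map h 1 z) + TensorProduct.map π 1 z := by
    have := LinearMap.congr_fun key1 z
    simp only [LinearMap.add_apply, Module.End.mul_apply, LinearMap.sub_apply,
      Module.End.one_apply, hz, map_zero, add_zero] at this
    rw [this, sub_add_cancel]
  have hz2 : tensorD dV ε dW (TensorProduct.map π 1 z) = 0 := by
    have := congrArg (tensorD dV ε dW) hz1
    rw [hz, map_add, ← Module.End.mul_apply (tensorD dV ε dW), key2, LinearMap.zero_apply,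
      zero_add] at this
    exact this.symm
  have hz3 : TensorProduct.map π dW z = 0 := by
    have e1 : TensorProduct.map ε 1 * (tensorD dV ε dW * TensorProduct.map π 1) =
        TensorProduct.map π dW := by
      unfold tensorD
      ext v w
      have e2 := LinearMap.congr_fun hπ v
      have e3 := LinearMap.congr_fun hεε (π v)
      simp only [Module.End.mul_apply, LinearMap.zero_apply, Module.End.one_apply] at e2 e3
      simp only [AlgebraTensorModule.curry_apply, LinearMap.restrictScalars_self, curry_apply,
        LinearMap.add_apply, Module.End.mul_apply, TensorProduct.map_tmul,
        Module.End.one_apply, e2, e3, TensorProduct.zero_tmul, zero_add]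
    rw [← e1, Module.End.mul_apply, Module.End.mul_apply, hz2, map_zero]
  have key3 : tensorD dV ε dW * TensorProduct.map (ε * π) h' +
      TensorProduct.map 1 h' * TensorProduct.map π dW + TensorProduct.map π π' =
      TensorProduct.map π 1 := by
    unfold tensorD
    ext v w
    have e1 := LinearMap.congr_fun hπ v
    have e2 := LinearMap.congr_fun hεε (π v)
    have e3 := LinearMap.congr_fun hεd (π v)
    have e4 := LinearMap.congr_fun hh' w
    simp only [Module.End.mul_apply, LinearMap.zero_apply, Module.End.one_apply,
      LinearMap.neg_apply, LinearMap.add_apply, LinearMap.sub_apply] at e1 e2 e3 e4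
    have e5 : dV (ε (π v)) = 0 := by
      rw [e1, map_zero] at e3
      exact neg_eq_zero.1 e3.symm
    simp only [AlgebraTensorModule.curry_apply, LinearMap.restrictScalars_self, curry_apply,
      LinearMap.add_apply, Module.End.mul_apply, TensorProduct.map_tmul,
      Module.End.one_apply, e2, e5, TensorProduct.zero_tmul, zero_add]
    rw [← TensorProduct.tmul_add, ← TensorProduct.tmul_add, e4, sub_add_cancel]
  have hz4 := LinearMap.congr_fun key3 z
  simp only [LinearMap.add_apply, Module.End.mul_apply, hz3, map_zero, add_zero] at hz4
  refine ⟨TensorProduct.map h 1 z + TensorProduct.map (ε * π) h' z, ?_⟩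
  rw [map_add, add_assoc, hz4]
  exact hz1

theorem exists_functional {d : Module.End k V} {z : V} (hz : z ∉ LinearMap.range d) :
    ∃ φ : V →ₗ[k] k, φ ∘ₗ d = 0 ∧ φ z = 1 := by
  obtain ⟨φ, hφz, hφ⟩ := Submodule.exists_le_ker_of_notMem hz
  refine ⟨(φ z)⁻¹ • φ, ?_, ?_⟩
  · ext x
    have : φ (d x) = 0 := hφ ⟨x, rfl⟩
    simp [this]
  · simp [hφz]

theorem tmul_notMem_range_tensorD {dV ε : Module.End k V} {dW : Module.End k W} {z : V} {w : W}
    (hz : z ∉ LinearMap.range dV) (hw : w ∉ LinearMap.range dW) :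
    z ⊗ₜ[k] w ∉ LinearMap.range (tensorD dV ε dW) := by
  rintro ⟨t, ht⟩
  obtain ⟨φ, hφ, hφz⟩ := exists_functional hz
  obtain ⟨ψ, hψ, hψw⟩ := exists_functional hw
  have h0 : TensorProduct.map φ ψ ∘ₗ tensorD dV ε dW = 0 := by
    unfold tensorD
    ext v w
    have e1 := LinearMap.congr_fun hφ v
    have e2 := LinearMap.congr_fun hψ w
    simp only [LinearMap.comp_apply, LinearMap.zero_apply] at e1 e2
    simp [e1, e2]
  have h1 := LinearMap.congr_fun h0 t
  rw [LinearMap.comp_apply, ht, TensorProduct.map_tmul, hφz, hψw, LinearMap.zero_apply] at h1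
  have h2 := congrArg (TensorProduct.lid k k) h1
  simp at h2

end LinearAlgebra

section TensorChains

open TensorProduct

variable {k : Type} [Field k] {σ τ : Type}

/-- The multiplication map `k[σ] ⊗ k[τ] → k[σ ⊔ τ]`, as a linear map. -/
def mulRename (k σ τ : Type) [Field k] :
    MvPolynomial σ k ⊗[k] MvPolynomial τ k →ₗ[k] MvPolynomial (σ ⊕ τ) k :=
  TensorProduct.lift ((LinearMap.mul k (MvPolynomial (σ ⊕ τ) k)).compl₁₂
    (rename Sum.inl).toLinearMap (rename Sum.inr).toLinearMap)

theorem mulRename_tmul (f : MvPolynomial σ k) (g : MvPolynomial τ k) :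
    mulRename k σ τ (f ⊗ₜ g) = rename Sum.inl f * rename Sum.inr g := rfl

theorem mulRename_bijective : Function.Bijective (mulRename k σ τ) := by
  have h : mulRename k σ τ = (tensorEquivSum k σ τ k).toLinearMap := by
    refine TensorProduct.ext' fun f g => ?_
    have h1 : (tensorEquivSum k σ τ k).toAlgHom.comp Algebra.TensorProduct.includeLeft =
        rename Sum.inl := by
      ext i
      simp
    have h2 : ((tensorEquivSum k σ τ k).toAlgHom.comp Algebra.TensorProduct.includeRight) =
        rename Sum.inr := by
      ext i
      simp
    have h3 := DFunLike.congr_fun h1 f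
    have h4 := DFunLike.congr_fun h2 g
    simp only [AlgHom.comp_apply, Algebra.TensorProduct.includeLeft_apply,
      Algebra.TensorProduct.includeRight_apply] at h3 h4
    rw [mulRename_tmul, ← h3, ← h4, ← map_mul, Algebra.TensorProduct.tmul_mul_tmul, mul_one,
      one_mul]
    rfl
  rw [h]
  exact (tensorEquivSum k σ τ k).bijective

variable (I : Ideal (MvPolynomial σ k)) (J : Ideal (MvPolynomial τ k))

/-- The multiplication map `I ⊗ J → k[σ ⊔ τ]`. -/
def mulIdeals : I ⊗[k] J →ₗ[k] MvPolynomial (σ ⊕ τ) k :=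
  mulRename k σ τ ∘ₗ
    TensorProduct.map (I.subtype.restrictScalars k) (J.subtype.restrictScalars k)

theorem mulIdeals_tmul (f : I) (g : J) :
    mulIdeals I J (f ⊗ₜ g) = rename Sum.inl (f : MvPolynomial σ k) * rename Sum.inr (g : MvPolynomial τ k) := rfl

theorem mulIdeals_injective : Function.Injective (mulIdeals I J) :=
  mulRename_bijective.1.comp
    (TensorProduct.map_injective_of_flat_flat _ _ (by exact Subtype.val_injective) (by exact Subtype.val_injective))

theorem mul_mulIdeals (x : MvPolynomial (σ ⊕ τ) k) (t : I ⊗[k] J) :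
    x * mulIdeals I J t ∈ LinearMap.range (mulIdeals I J) := by
  obtain ⟨u, rfl⟩ := mulRename_bijective.2 x
  induction u using TensorProduct.induction_on with
  | zero => rw [map_zero, zero_mul]; exact zero_mem _
  | add u v hu hv => rw [map_add, add_mul]; exact add_mem hu hv
  | tmul f g =>
    induction t using TensorProduct.induction_on with
    | zero => rw [map_zero, mul_zero]; exact zero_mem _
    | add u v hu hv => rw [map_add, mul_add]; exact add_mem hu hv
    | tmul a b =>
      refine ⟨(f • a) ⊗ₜ (g • b), ?_⟩
      simp only [mulIdeals_tmul, mulRename_tmul, Submodule.coe_smul, smul_eq_mul, map_mul]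
      ring

theorem mem_map_mul_map_iff {x : MvPolynomial (σ ⊕ τ) k} :
    x ∈ I.map (rename Sum.inl : MvPolynomial σ k →ₐ[k] MvPolynomial (σ ⊕ τ) k) *
      J.map (rename Sum.inr : MvPolynomial τ k →ₐ[k] MvPolynomial (σ ⊕ τ) k) ↔
      x ∈ LinearMap.range (mulIdeals I J) := by
  constructor
  · intro hx
    rw [Ideal.map, Ideal.map, Ideal.span_mul_span'] at hx
    induction hx using Submodule.span_induction with
    | mem x hx =>
      obtain ⟨_, ⟨a, ha, rfl⟩, _, ⟨b, hb, rfl⟩, rfl⟩ := hx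
      exact ⟨⟨a, ha⟩ ⊗ₜ ⟨b, hb⟩, rfl⟩
    | zero => exact zero_mem _
    | add x y _ _ hx hy => exact add_mem hx hy
    | smul a x _ hx =>
      obtain ⟨t, rfl⟩ := hx
      exact mul_mulIdeals I J a t
  · rintro ⟨t, rfl⟩
    induction t using TensorProduct.induction_on with
    | zero => rw [map_zero]; exact zero_mem _
    | add u v hu hv => rw [map_add]; exact add_mem hu hv
    | tmul a b => exact Ideal.mul_mem_mul (Ideal.mem_map_of_mem _ a.2) (Ideal.mem_map_of_mem _ b.2)

theorem map_inf_map_eq_mul :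
    I.map (rename Sum.inl : MvPolynomial σ k →ₐ[k] MvPolynomial (σ ⊕ τ) k) ⊓
      J.map (rename Sum.inr : MvPolynomial τ k →ₐ[k] MvPolynomial (σ ⊕ τ) k) =
    I.map (rename Sum.inl : MvPolynomial σ k →ₐ[k] MvPolynomial (σ ⊕ τ) k) *
      J.map (rename Sum.inr : MvPolynomial τ k →ₐ[k] MvPolynomial (σ ⊕ τ) k) := by
  refine le_antisymm (fun x hx => ?_) Ideal.mul_le_inf
  obtain ⟨t₁, ht₁⟩ : x ∈ LinearMap.range (mulIdeals I (⊤ : Ideal (MvPolynomial τ k))) := by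
    rw [← mem_map_mul_map_iff, Ideal.map_top, Ideal.mul_top]
    exact hx.1
  obtain ⟨t₂, ht₂⟩ : x ∈ LinearMap.range (mulIdeals (⊤ : Ideal (MvPolynomial σ k)) J) := by
    rw [← mem_map_mul_map_iff, Ideal.map_top, Ideal.top_mul]
    exact hx.2
  obtain ⟨t, rfl⟩ := mulRename_bijective.2 x
  replace ht₁ := mulRename_bijective.1 ht₁
  replace ht₂ := mulRename_bijective.1 ht₂
  obtain ⟨P, hP⟩ := (I.subtype.restrictScalars k).exists_leftInverse_of_injective
    (LinearMap.ker_eq_bot.2 Subtype.val_injective)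
  obtain ⟨Q, hQ⟩ := (J.subtype.restrictScalars k).exists_leftInverse_of_injective
    (LinearMap.ker_eq_bot.2 Subtype.val_injective)
  rw [mem_map_mul_map_iff]
  refine ⟨TensorProduct.map P Q t, congrArg (mulRename k σ τ) ?_⟩
  have h1 : TensorProduct.map (I.subtype.restrictScalars k ∘ₗ P) LinearMap.id t = t := by
    rw [← ht₁, ← LinearMap.comp_apply, ← TensorProduct.map_comp, LinearMap.comp_assoc, hP]
    rfl
  have h2 : TensorProduct.map LinearMap.id (J.subtype.restrictScalars k ∘ₗ Q) t = t := by
    rw [← ht₂, ← LinearMap.comp_apply, ← TensorProduct.map_comp, LinearMap.comp_assoc, hQ]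
    rfl
  rw [← LinearMap.comp_apply, ← TensorProduct.map_comp]
  conv_rhs => rw [← h1, ← h2, ← LinearMap.comp_apply, ← TensorProduct.map_comp]
  rfl

end TensorChains

section SumOrder

variable {k : Type} [Field k] {σ τ : Type} [Fintype σ] [DecidableEq σ] [Fintype τ] [DecidableEq τ]

/-- The ordering of the variables `σ ⊔ τ` in which `σ` precedes `τ`. -/
def ordSum (o₁ : σ → ℕ) (o₂ : τ → ℕ) (N : ℕ) : σ ⊕ τ → ℕ := Sum.elim o₁ (fun j => N + o₂ j)

theorem ordSum_injective {o₁ : σ → ℕ} {o₂ : τ → ℕ} {N : ℕ} (h₁ : Function.Injective o₁)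
    (h₂ : Function.Injective o₂) (hN : ∀ i, o₁ i < N) : Function.Injective (ordSum o₁ o₂ N) := by
  refine h₁.sumElim (fun a b h => h₂ (by simpa using h)) fun i j => ?_
  have := hN i
  omega

theorem ksgn_inl {o₁ : σ → ℕ} {o₂ : τ → ℕ} {N : ℕ} (hN : ∀ i, o₁ i < N) (i : σ)
    (T : Finset (σ ⊕ τ)) : ksgn (ordSum o₁ o₂ N) (Sum.inl i) T = ksgn o₁ i T.toLeft := by
  unfold ksgn
  have h : T.filter (ordSum o₁ o₂ N · < ordSum o₁ o₂ N (Sum.inl i)) =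
      (T.toLeft.filter (o₁ · < o₁ i)).disjSum ∅ := by
    ext x
    have := hN i
    rw [Finset.mem_filter]
    rcases x with x | x
    · simp [ordSum]
    · simp only [ordSum, Sum.elim_inr, Sum.elim_inl, Finset.inr_mem_disjSum,
        Finset.notMem_empty, iff_false, not_and, not_lt]
      intro _
      omega
  rw [h, Finset.card_disjSum, Finset.card_empty, add_zero]

theorem ksgn_inr {o₁ : σ → ℕ} {o₂ : τ → ℕ} {N : ℕ} (hN : ∀ i, o₁ i < N) (j : τ)
    (T : Finset (σ ⊕ τ)) : ksgn (ordSum o₁ o₂ N) (Sum.inr j) T =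
      (-1) ^ T.toLeft.card * ksgn o₂ j T.toRight := by
  unfold ksgn
  have h : T.filter (ordSum o₁ o₂ N · < ordSum o₁ o₂ N (Sum.inr j)) =
      T.toLeft.disjSum (T.toRight.filter (o₂ · < o₂ j)) := by
    ext x
    rw [Finset.mem_filter]
    rcases x with x | x
    · have := hN x
      simp only [ordSum, Sum.elim_inr, Sum.elim_inl, Finset.inl_mem_disjSum,
        Finset.mem_toLeft, and_iff_left_iff_imp]
      intro _
      omega
    · simp [ordSum]
  rw [h, Finset.card_disjSum, pow_add]

theorem kd_ordSum_apply {o₁ : σ → ℕ} {o₂ : τ → ℕ} {N : ℕ} (hN : ∀ i, o₁ i < N)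
    (z : Finset (σ ⊕ τ) → MvPolynomial (σ ⊕ τ) k) (T : Finset (σ ⊕ τ)) :
    kd (k := k) (ordSum o₁ o₂ N) z T =
      ∑ i ∈ T.toLeftᶜ, ksgn o₁ i T.toLeft • X (Sum.inl i) * z (insert (Sum.inl i) T) +
      ∑ j ∈ T.toRightᶜ, (-1 : ℤ) ^ T.toLeft.card • (ksgn o₂ j T.toRight • X (Sum.inr j) *
        z (insert (Sum.inr j) T)) := by
  have h : Tᶜ = T.toLeftᶜ.disjSum T.toRightᶜ := by
    ext x
    rcases x with x | x <;> simp
  rw [kd_apply, h, Finset.sum_disjSum]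
  simp only [ksgn_inl hN, ksgn_inr hN, smul_eq_mul, smul_mul_assoc]
  congr 1
  refine Finset.sum_congr rfl fun j _ => ?_
  rw [mul_smul]

end SumOrder

section Parity

variable (k : Type) [Field k] {σ : Type} (M : Type) [AddCommGroup M] [Module k M]

/-- The projection of Koszul chains onto those of even exterior degree. -/
def evenPart : Module.End k (Finset σ → M) where
  toFun c T := if Even T.card then c T else 0
  map_add' c c' := by
    funext T
    by_cases h : Even T.card <;> simp [h]
  map_smul' a c := by
    funext T
    by_cases h : Even T.card <;> simp [h]

/-- The operator multiplying a Koszul chain of exterior degree `q` by `(-1)^q`. -/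
def paritySign : Module.End k (Finset σ → M) :=
  evenPart k M - (1 - evenPart k M)

variable {k M}

theorem evenPart_apply (c : Finset σ → M) (T : Finset σ) :
    evenPart k M c T = if Even T.card then c T else 0 := rfl

theorem paritySign_apply (c : Finset σ → M) (T : Finset σ) :
    paritySign k M c T = (-1 : ℤ) ^ T.card • c T := by
  have : paritySign k M c T = evenPart k M c T - (c T - evenPart k M c T) := rfl
  rw [this, evenPart_apply]
  split_ifs with h
  · rw [h.neg_one_pow, one_smul, sub_self, sub_zero]
  · rw [(Nat.not_even_iff_odd.1 h).neg_one_pow, neg_one_smul, sub_zero, zero_sub]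

theorem evenPart_mul_self : evenPart k M * evenPart k M = (evenPart k M : Module.End k (Finset σ → M)) := by
  refine LinearMap.ext fun c => funext fun T => ?_
  simp only [Module.End.mul_apply, evenPart_apply]
  split_ifs <;> rfl

theorem paritySign_mul_self : paritySign k M * paritySign k M = (1 : Module.End k (Finset σ → M)) := by
  refine LinearMap.ext fun c => funext fun T => ?_
  rw [Module.End.mul_apply, paritySign_apply, paritySign_apply, smul_smul, ← pow_add,
    (Even.add_self _).neg_one_pow, one_smul, Module.End.one_apply]

variable [Module (MvPolynomial σ k) M] [IsScalarTower k (MvPolynomial σ k) M]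
  [Fintype σ] [DecidableEq σ]

variable (k M) in
/-- The Koszul differential as an endomorphism over the ground field. -/
def kdEnd (o : σ → ℕ) : Module.End k (Finset σ → M) :=
  (kd (k := k) (M := M) o).restrictScalars k

theorem kdEnd_apply (o : σ → ℕ) (z : Finset σ → M) : kdEnd k M o z = kd (k := k) o z := rfl

theorem kdEnd_mul_self {o : σ → ℕ} (ho : Function.Injective o) : kdEnd k M o * kdEnd k M o = 0 :=
  LinearMap.ext fun z => kd_kd ho z

theorem kdEnd_mul_evenPart (o : σ → ℕ) :
    kdEnd k M o * evenPart k M = (1 - evenPart k M) * kdEnd k M o := by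
  refine LinearMap.ext fun z => funext fun T => ?_
  have h1 : ((1 - evenPart k M) * kdEnd k M o : Module.End k (Finset σ → M)) z T =
      kd (k := k) o z T - evenPart k M (kd (k := k) o z) T := rfl
  rw [h1, Module.End.mul_apply, kdEnd_apply, kd_apply, evenPart_apply, kd_apply]
  have h2 : ∀ i ∈ Tᶜ, evenPart k M z (insert i T) = if Even T.card then 0 else z (insert i T) := by
    intro i hi
    rw [evenPart_apply, Finset.card_insert_of_notMem (Finset.mem_compl.1 hi)]
    simp only [Nat.even_add_one, ite_not]
  rw [Finset.sum_congr rfl fun i hi => by rw [h2 i hi]]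
  split_ifs
  · simp
  · simp

theorem paritySign_mul_kdEnd (o : σ → ℕ) :
    paritySign k M * kdEnd k M o = -(kdEnd k M o * paritySign k M) := by
  unfold paritySign
  have h := kdEnd_mul_evenPart (k := k) (M := M) o
  have h' : kdEnd k M o * (1 - evenPart k M) = evenPart k M * kdEnd k M o := by
    rw [mul_sub, h, mul_one, sub_mul, one_mul, sub_sub_cancel]
  rw [mul_sub, h', h, sub_mul, neg_sub]

end Parity

section Kunneth

open TensorProduct

variable {k : Type} [Field k] {σ τ : Type}

theorem sum_compZ_of_totalDegree_lt {p : MvPolynomial σ k} {N : ℕ} (h : p.totalDegree < N) :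
    p = ∑ i ∈ Finset.range N, compZ (i : ℤ) p := by
  conv_lhs => rw [sum_compZ p]
  refine Finset.sum_subset (Finset.range_mono h) fun i _ hi => ?_
  simp only [compZ, Nat.cast_nonneg, if_true, Int.toNat_natCast]
  exact homogeneousComponent_eq_zero _ _ (by simpa [Nat.lt_succ_iff] using hi)

theorem compZ_mul_eq_zero {f g : MvPolynomial σ k} {α β : ℤ} (hf : ∀ t > α, compZ t f = 0)
    (hg : ∀ t > β, compZ t g = 0) {u : ℤ} (hu : α + β < u) : compZ u (f * g) = 0 := by
  rw [sum_compZ f, Finset.sum_mul, map_sum]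
  refine Finset.sum_eq_zero fun i _ => ?_
  rw [compZ_mul_left (homogZ_compZ (i : ℤ) f)]
  by_cases h : α < i
  · rw [hf i h, zero_mul]
  · rw [hg (u - i) (by linarith), mul_zero]

variable [Fintype σ] [DecidableEq σ] [Fintype τ] [DecidableEq τ]

section Ideal

variable {o : σ → ℕ} {I : Ideal (MvPolynomial σ k)}

/-- The Koszul cycles with coefficients in `I` all of whose components have degree at most `ρ`. -/
def boundedCycles (o : σ → ℕ) (I : Ideal (MvPolynomial σ k)) (ρ : ℤ) :
    Submodule k (Finset σ → I) where
  carrier := {c | kdEnd k I o c = 0 ∧ ∀ T, ∀ t > ρ, compZ t (c T : MvPolynomial σ k) = 0}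
  zero_mem' := ⟨map_zero _, fun T t _ => by simp⟩
  add_mem' {c c'} hc hc' := ⟨by rw [map_add, hc.1, hc'.1, add_zero], fun T t ht => by
    rw [Pi.add_apply, Submodule.coe_add, map_add, hc.2 T t ht, hc'.2 T t ht, add_zero]⟩
  smul_mem' a c hc := ⟨by rw [map_smul, hc.1, smul_zero], fun T t ht => by
    have h : ((a • c) T : MvPolynomial σ k) = a • (c T : MvPolynomial σ k) := rfl
    rw [h, map_smul, hc.2 T t ht, smul_zero]⟩

theorem coe_kdEnd (o : σ → ℕ) (c : Finset σ → I) (T : Finset σ) :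
    ((kdEnd k I o c T : I) : MvPolynomial σ k) =
      kd (k := k) o (fun T => (c T : MvPolynomial σ k)) T :=
  congrFun (kd_coe_ideal o c) T

theorem kdEnd_eq_zero_iff {c : Finset σ → I} :
    kdEnd k I o c = 0 ↔ kd (k := k) o (fun T => (c T : MvPolynomial σ k)) = 0 := by
  constructor
  · intro h
    funext T
    rw [← coe_kdEnd, h]
    rfl
  · intro h
    funext T
    refine Subtype.ext ?_
    rw [coe_kdEnd, h]
    rfl

theorem IReg.ker_le (hI : IsHomogeneousIdeal k I) {ρ : ℤ} (h : IReg k o I ρ) :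
    LinearMap.ker (kdEnd k I o) ≤ LinearMap.range (kdEnd k I o) ⊔ boundedCycles o I ρ := by
  intro c hc
  have hc' := kdEnd_eq_zero_iff.1 (LinearMap.mem_ker.1 hc)
  let cc (u : ℤ) : Finset σ → I := fun T => ⟨compZ u (c T : MvPolynomial σ k), hI.compZ_mem (c T).2 u⟩
  have hcc (u : ℤ) : kd (k := k) o (fun T => (cc u T : MvPolynomial σ k)) = 0 := by
    funext T
    have := compZ_kd o (u + 1) (fun T => (c T : MvPolynomial σ k)) T
    rw [hc', add_sub_cancel_right] at this
    rw [← this]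
    exact map_zero _
  have hsum : c = ∑ u ∈ Finset.range (Finset.univ.sup (fun T => (c T : MvPolynomial σ k).totalDegree) + 1),
      cc (u : ℤ) := by
    funext T
    refine Subtype.ext ?_
    rw [Finset.sum_apply, AddSubmonoidClass.coe_finsetSum]
    exact sum_compZ_of_totalDegree_lt (Nat.lt_succ_of_le (Finset.le_sup
      (f := fun T => (c T : MvPolynomial σ k).totalDegree) (Finset.mem_univ T)))
  rw [hsum]
  refine Submodule.sum_mem _ fun u _ => ?_
  by_cases hu : ρ < u
  · refine Submodule.mem_sup_left ?_
    obtain ⟨w, hwI, hw⟩ := h u hu (fun T => cc u T) (fun T => (cc u T).2)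
      (fun T => homogZ_compZ _ _) (hcc u)
    refine ⟨fun T => ⟨w T, hwI T⟩, ?_⟩
    funext T
    refine Subtype.ext ?_
    rw [coe_kdEnd, hw]
  · refine Submodule.mem_sup_right ⟨kdEnd_eq_zero_iff.2 (hcc u), fun T t ht => ?_⟩
    exact compZ_of_ne (homogZ_compZ _ _) (by omega)

theorem IReg.exists_homotopy (ho : Function.Injective o) (hI : IsHomogeneousIdeal k I) {ρ : ℤ}
    (h : IReg k o I ρ) :
    ∃ h π : Module.End k (Finset σ → I), kdEnd k I o * h + h * kdEnd k I o = 1 - π ∧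
      (∀ x, π x ∈ boundedCycles o I ρ) ∧ paritySign k I * h = -(h * paritySign k I) := by
  refine exists_odd_homotopy _ (kdEnd_mul_self ho) _ (h.ker_le hI) (evenPart k I)
    evenPart_mul_self (kdEnd_mul_evenPart o) fun y hy => ⟨?_, fun T t ht => ?_⟩
  · have h1 := LinearMap.congr_fun (kdEnd_mul_evenPart (k := k) (M := I) o) y
    rw [Module.End.mul_apply, Module.End.mul_apply, hy.1, map_zero] at h1
    exact h1
  · rw [evenPart_apply]
    split_ifs
    · exact hy.2 T t ht
    · simp

theorem exists_of_not_iReg {ρ : ℤ} (h : ¬ IReg k o I ρ) :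
    ∃ u > ρ, ∃ z : Finset σ → I, (∀ T, homogZ k (z T : MvPolynomial σ k) u) ∧
      kdEnd k I o z = 0 ∧ z ∉ LinearMap.range (kdEnd k I o) := by
  unfold IReg at h
  push Not at h
  obtain ⟨u, hu, z, hzI, hz, hd, hw⟩ := h
  refine ⟨u, hu, fun T => ⟨z T, hzI T⟩, hz, kdEnd_eq_zero_iff.2 hd, ?_⟩
  rintro ⟨w, h⟩
  refine hw (fun T => w T) (fun T => (w T).2) ?_
  funext T
  rw [← coe_kdEnd, h]

end Ideal

variable (I : Ideal (MvPolynomial σ k)) (J : Ideal (MvPolynomial τ k))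

/-- The comparison map from the tensor product of two Koszul complexes to the Koszul complex on
the union of the variables. -/
def tensorChain : (Finset σ → I) ⊗[k] (Finset τ → J) →ₗ[k]
    (Finset (σ ⊕ τ) → MvPolynomial (σ ⊕ τ) k) :=
  LinearMap.pi fun T => mulIdeals I J ∘ₗ
    TensorProduct.map (LinearMap.proj T.toLeft) (LinearMap.proj T.toRight)

variable {I J}

theorem tensorChain_apply (t : (Finset σ → I) ⊗[k] (Finset τ → J)) (T : Finset (σ ⊕ τ)) :
    tensorChain I J t T = mulIdeals I J
      (TensorProduct.map (LinearMap.proj T.toLeft) (LinearMap.proj T.toRight) t) := rfl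

theorem tensorChain_tmul (c : Finset σ → I) (d : Finset τ → J) (T : Finset (σ ⊕ τ)) :
    tensorChain I J (c ⊗ₜ d) T = rename Sum.inl (c T.toLeft : MvPolynomial σ k) *
      rename Sum.inr (d T.toRight : MvPolynomial τ k) := rfl

theorem kd_tensorChain {o₁ : σ → ℕ} {o₂ : τ → ℕ} {N : ℕ} (hN : ∀ i, o₁ i < N)
    (t : (Finset σ → I) ⊗[k] (Finset τ → J)) :
    kd (k := k) (ordSum o₁ o₂ N) (tensorChain I J t) =
      tensorChain I J (tensorD (kdEnd k I o₁) (paritySign k I) (kdEnd k J o₂) t) := by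
  induction t using TensorProduct.induction_on with
  | zero => simp only [map_zero]
  | add u v hu hv => rw [map_add, map_add, hu, hv, map_add, map_add]
  | tmul c d =>
    funext T
    have h1 : tensorD (kdEnd k I o₁) (paritySign k I) (kdEnd k J o₂) (c ⊗ₜ d) =
        kdEnd k I o₁ c ⊗ₜ d + paritySign k I c ⊗ₜ kdEnd k J o₂ d := rfl
    rw [h1, map_add, Pi.add_apply, tensorChain_tmul, tensorChain_tmul, coe_kdEnd, coe_kdEnd,
      kd_ordSum_apply hN, kd_apply, kd_apply, map_sum, map_sum, Finset.sum_mul, Finset.mul_sum]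
    congr 1
    · refine Finset.sum_congr rfl fun i _ => ?_
      rw [tensorChain_tmul, Finset.toLeft_insert_inl, Finset.toRight_insert_inl, map_zsmul,
        smul_mul_assoc, smul_mul_assoc, smul_eq_mul, map_mul, rename_X, mul_assoc]
    · refine Finset.sum_congr rfl fun j _ => ?_
      have h2 : ((paritySign k I c T.toLeft : I) : MvPolynomial σ k) =
          (-1 : ℤ) ^ T.toLeft.card • (c T.toLeft : MvPolynomial σ k) := by
        rw [paritySign_apply]; rfl
      rw [tensorChain_tmul, Finset.toLeft_insert_inr, Finset.toRight_insert_inr, h2, map_zsmul,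
        map_zsmul, smul_mul_assoc, smul_mul_assoc, smul_eq_mul, map_mul, rename_X, mul_smul_comm,
        mul_left_comm]

theorem single_proj_tensor (t : (Finset σ → I) ⊗[k] (Finset τ → J)) :
    ∑ S, ∑ T, TensorProduct.map (LinearMap.single k (fun _ => I) S)
      (LinearMap.single k (fun _ => J) T)
      (TensorProduct.map (LinearMap.proj S) (LinearMap.proj T) t) = t := by
  induction t using TensorProduct.induction_on with
  | zero => simp only [map_zero, Finset.sum_const_zero]
  | add u v hu hv => simp only [map_add, Finset.sum_add_distrib, hu, hv]
  | tmul c d =>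
    simp only [TensorProduct.map_tmul, LinearMap.proj_apply, LinearMap.single_apply]
    simp only [← TensorProduct.tmul_sum, ← TensorProduct.sum_tmul]
    congr 1
    · exact Finset.univ_sum_single c
    · exact Finset.univ_sum_single d

theorem tensorChain_injective : Function.Injective (tensorChain I J) := by
  refine (injective_iff_map_eq_zero _).2 fun t ht => ?_
  rw [← single_proj_tensor t]
  refine Finset.sum_eq_zero fun S _ => Finset.sum_eq_zero fun T _ => ?_
  have h := congrFun ht (S.disjSum T)
  rw [tensorChain_apply, Finset.toLeft_disjSum, Finset.toRight_disjSum] at h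
  rw [(map_eq_zero_iff _ (mulIdeals_injective I J)).1 h, map_zero]

theorem exists_tensorChain_eq {z : Finset (σ ⊕ τ) → MvPolynomial (σ ⊕ τ) k}
    (hz : ∀ T, z T ∈ LinearMap.range (mulIdeals I J)) : ∃ t, tensorChain I J t = z := by
  choose g hg using hz
  refine ⟨∑ T, TensorProduct.map (LinearMap.single k (fun _ => I) T.toLeft)
      (LinearMap.single k (fun _ => J) T.toRight) (g T), ?_⟩
  funext T
  rw [map_sum, Finset.sum_apply, ← hg, Finset.sum_eq_single T]
  · rw [tensorChain_apply, ← LinearMap.comp_apply (TensorProduct.map _ _), ← TensorProduct.map_comp,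
      LinearMap.proj_comp_single_same, LinearMap.proj_comp_single_same, TensorProduct.map_id]
    rfl
  · intro S _ hST
    rw [tensorChain_apply, ← LinearMap.comp_apply (TensorProduct.map _ _), ← TensorProduct.map_comp]
    by_cases h : S.toLeft = T.toLeft
    · have h' : S.toRight ≠ T.toRight := fun h' => hST (by
        rw [← Finset.toLeft_disjSum_toRight (u := S), h, h', Finset.toLeft_disjSum_toRight])
      rw [LinearMap.proj_comp_single_ne k (fun _ => J) _ _ h'.symm, TensorProduct.map_zero_right]
      simp
    · rw [LinearMap.proj_comp_single_ne k (fun _ => I) _ _ (Ne.symm h), TensorProduct.map_zero_left]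
      simp
  · intro h
    exact absurd (Finset.mem_univ _) h

theorem tensorChain_mem (t : (Finset σ → I) ⊗[k] (Finset τ → J)) (T : Finset (σ ⊕ τ)) :
    tensorChain I J t T ∈ LinearMap.range (mulIdeals I J) := ⟨_, rfl⟩

theorem compZ_tensorChain_map_eq_zero {o₁ : σ → ℕ} {o₂ : τ → ℕ} {α β : ℤ}
    {π : Module.End k (Finset σ → I)} {π' : Module.End k (Finset τ → J)}
    (hπ : ∀ x, π x ∈ boundedCycles o₁ I α) (hπ' : ∀ x, π' x ∈ boundedCycles o₂ J β) {u : ℤ}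
    (hu : α + β < u) (t : (Finset σ → I) ⊗[k] (Finset τ → J)) (T : Finset (σ ⊕ τ)) :
    compZ u (tensorChain I J (TensorProduct.map π π' t) T) = 0 := by
  induction t using TensorProduct.induction_on with
  | zero => simp only [map_zero, Pi.zero_apply]
  | add x y hx hy => rw [map_add, map_add, Pi.add_apply, map_add, hx, hy, add_zero]
  | tmul c d =>
    rw [TensorProduct.map_tmul, tensorChain_tmul]
    refine compZ_mul_eq_zero (fun t ht => ?_) (fun t ht => ?_) hu
    · rw [compZ_rename Sum.inl_injective, (hπ c).2 _ t ht, map_zero]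
    · rw [compZ_rename Sum.inr_injective, (hπ' d).2 _ t ht, map_zero]

theorem IReg.map_mul_map {o₁ : σ → ℕ} {o₂ : τ → ℕ} {N : ℕ} (h₁ : Function.Injective o₁)
    (h₂ : Function.Injective o₂) (hN : ∀ i, o₁ i < N) (hI : IsHomogeneousIdeal k I)
    (hJ : IsHomogeneousIdeal k J) {α β : ℤ} (hα : IReg k o₁ I α) (hβ : IReg k o₂ J β) :
    IReg k (ordSum o₁ o₂ N)
      (I.map (rename Sum.inl : MvPolynomial σ k →ₐ[k] MvPolynomial (σ ⊕ τ) k) *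
        J.map (rename Sum.inr : MvPolynomial τ k →ₐ[k] MvPolynomial (σ ⊕ τ) k)) (α + β) := by
  intro u hu z hzIJ hz hd
  obtain ⟨t, rfl⟩ := exists_tensorChain_eq fun T => (mem_map_mul_map_iff I J).1 (hzIJ T)
  rw [kd_tensorChain hN, map_eq_zero_iff _ tensorChain_injective] at hd
  obtain ⟨h, π, hh, hπ, hεh⟩ := hα.exists_homotopy h₁ hI
  obtain ⟨h', π', hh', hπ', -⟩ := hβ.exists_homotopy h₂ hJ
  obtain ⟨w, hw⟩ := tensor_cycle_decomposition (kdEnd_mul_self h₁) (kdEnd_mul_self h₂)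
    paritySign_mul_self (paritySign_mul_kdEnd o₁) hh hεh
    (LinearMap.ext fun x => (hπ x).1) hh' hd
  have hIJ := (hI.map_rename (τ := σ ⊕ τ) Sum.inl_injective).mul
    (hJ.map_rename (τ := σ ⊕ τ) Sum.inr_injective)
  refine ⟨fun T => compZ (u - 1) (tensorChain I J w T), fun T =>
    hIJ.compZ_mem ((mem_map_mul_map_iff I J).2 (tensorChain_mem w T)) _, ?_⟩
  funext T
  rw [← compZ_kd, kd_tensorChain hN]
  conv_rhs => rw [← compZ_of_homogZ (hz T), hw, map_add, Pi.add_apply, map_add,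
    compZ_tensorChain_map_eq_zero hπ hπ' hu, add_zero]

theorem not_iReg_map_mul_map {o₁ : σ → ℕ} {o₂ : τ → ℕ} {N : ℕ} (hN : ∀ i, o₁ i < N) {α β : ℤ}
    (hα : ¬ IReg k o₁ I α) (hβ : ¬ IReg k o₂ J β) :
    ¬ IReg k (ordSum o₁ o₂ N)
      (I.map (rename Sum.inl : MvPolynomial σ k →ₐ[k] MvPolynomial (σ ⊕ τ) k) *
        J.map (rename Sum.inr : MvPolynomial τ k →ₐ[k] MvPolynomial (σ ⊕ τ) k)) (α + β + 1) := by
  obtain ⟨u, hu, z, hz, hzd, hzr⟩ := exists_of_not_iReg hα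
  obtain ⟨v, hv, w, hw, hwd, hwr⟩ := exists_of_not_iReg hβ
  intro h
  obtain ⟨x, hx, hxd⟩ := h (u + v) (by omega) (tensorChain I J (z ⊗ₜ w))
    (fun T => (mem_map_mul_map_iff I J).2 (tensorChain_mem _ T))
    (fun T => by
      rw [tensorChain_tmul]
      refine homogZ_mul ?_ ?_
      · rw [← compZ_of_homogZ (hz T.toLeft), ← compZ_rename Sum.inl_injective]
        exact homogZ_compZ _ _
      · rw [← compZ_of_homogZ (hw T.toRight), ← compZ_rename Sum.inr_injective]
        exact homogZ_compZ _ _)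
    (by
      have h1 : tensorD (kdEnd k I o₁) (paritySign k I) (kdEnd k J o₂) (z ⊗ₜ w) =
          kdEnd k I o₁ z ⊗ₜ w + paritySign k I z ⊗ₜ kdEnd k J o₂ w := rfl
      rw [kd_tensorChain hN, h1, hzd, hwd, TensorProduct.zero_tmul, TensorProduct.tmul_zero,
        add_zero, map_zero])
  obtain ⟨t, rfl⟩ := exists_tensorChain_eq fun T => (mem_map_mul_map_iff I J).1 (hx T)
  rw [kd_tensorChain hN] at hxd
  exact tmul_notMem_range_tensorD hzr hwr ⟨t, tensorChain_injective hxd⟩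

theorem map_rename_ne_bot {ι : Type} {g : σ → ι} (hg : Function.Injective g) (hI : I ≠ ⊥) :
    I.map (rename g : MvPolynomial σ k →ₐ[k] MvPolynomial ι k) ≠ ⊥ := by
  rwa [Ne, Ideal.map_eq_bot_iff_of_injective (rename_injective g hg)]

/-- The Künneth formula for the regularity of a product of ideals in disjoint sets of variables. -/
theorem regIdeal_map_mul_map {o₁ : σ → ℕ} {o₂ : τ → ℕ} {N : ℕ} (h₁ : Function.Injective o₁)
    (h₂ : Function.Injective o₂) (hN : ∀ i, o₁ i < N) (hI : IsHomogeneousIdeal k I)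
    (hJ : IsHomogeneousIdeal k J) (hI0 : I ≠ ⊥) (hJ0 : J ≠ ⊥) :
    regIdeal k (I.map (rename Sum.inl : MvPolynomial σ k →ₐ[k] MvPolynomial (σ ⊕ τ) k) *
        J.map (rename Sum.inr : MvPolynomial τ k →ₐ[k] MvPolynomial (σ ⊕ τ) k)) =
      regIdeal k I + regIdeal k J := by
  have hIJ := (hI.map_rename (τ := σ ⊕ τ) Sum.inl_injective).mul
    (hJ.map_rename (τ := σ ⊕ τ) Sum.inr_injective)
  have h0 := mul_ne_zero (map_rename_ne_bot (ι := σ ⊕ τ) Sum.inl_injective hI0)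
    (map_rename_ne_bot (ι := σ ⊕ τ) Sum.inr_injective hJ0)
  have ho := ordSum_injective h₁ h₂ hN
  refine le_antisymm ?_ (le_of_not_gt fun h => ?_)
  · rw [regIdeal_le_iff ho hIJ h0]
    exact IReg.map_mul_map h₁ h₂ hN hI hJ ((regIdeal_le_iff h₁ hI hI0).1 le_rfl)
      ((regIdeal_le_iff h₂ hJ hJ0).1 le_rfl)
  · refine not_iReg_map_mul_map (α := regIdeal k I - 1) (β := regIdeal k J - 1) hN
      (fun h => ?_) (fun h => ?_) ((regIdeal_le_iff ho hIJ h0).1 (by linarith))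
    · have := (regIdeal_le_iff h₁ hI hI0).2 h
      linarith
    · have := (regIdeal_le_iff h₂ hJ hJ0).2 h
      linarith

end Kunneth

section IdealIdentities

variable {S : Type} [CommRing S] (X Y : Ideal S)

theorem sup_pow_succ_eq (i : ℕ) : (X ⊔ Y) ^ (i + 1) = X ^ (i + 1) ⊔ Y * (X ⊔ Y) ^ i := by
  induction i with
  | zero => simp
  | succ i ih =>
    have h : X * (X ⊔ Y) ^ i ≤ (X ⊔ Y) ^ (i + 1) := by
      rw [pow_succ']
      exact Ideal.mul_mono_left le_sup_left
    rw [pow_succ' (X ⊔ Y) (i + 1), Ideal.sup_mul]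
    conv_lhs => rw [ih, Ideal.mul_sup, ← pow_succ', mul_left_comm, sup_assoc, ← ih, ← Ideal.mul_sup,
      sup_eq_right.2 h]

theorem pow_mul_sup_pow_succ (q i : ℕ) : Y ^ q * (X ⊔ Y) ^ (i + 1) =
    X ^ (i + 1) * Y ^ q ⊔ Y ^ (q + 1) * (X ⊔ Y) ^ i := by
  rw [sup_pow_succ_eq, Ideal.mul_sup, ← mul_assoc, ← pow_succ, mul_comm (Y ^ q)]

theorem sup_pow_add_eq (i q : ℕ) : (X ⊔ Y) ^ (i + q + 1) =
    X ^ (i + 1) * (X ⊔ Y) ^ q ⊔ Y ^ (q + 1) * (X ⊔ Y) ^ i := by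
  induction q with
  | zero => simpa using sup_pow_succ_eq X Y i
  | succ q ih =>
    have h : X ^ (i + 1) * Y ^ (q + 1) ≤ X ^ (i + 1) * (X ⊔ Y) ^ (q + 1) :=
      Ideal.mul_mono_right (Ideal.pow_right_mono le_sup_right _)
    rw [show i + (q + 1) + 1 = (i + q + 1) + 1 by ring, pow_succ, ih, Ideal.sup_mul, mul_assoc,
      mul_assoc, ← pow_succ, ← pow_succ, pow_mul_sup_pow_succ, ← sup_assoc, sup_eq_left.2 h]

variable {X Y}

theorem pow_mul_pow_inf (h : ∀ a b : ℕ, X ^ a ⊓ Y ^ b = X ^ a * Y ^ b) {a b i q : ℕ}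
    (hb : b ≤ q + 1) (ha : i ≤ a) :
    X ^ a * Y ^ b ⊓ Y ^ (q + 1) * (X ⊔ Y) ^ i = X ^ a * Y ^ (q + 1) := by
  refine le_antisymm ?_ (le_inf (Ideal.mul_mono_right (Ideal.pow_le_pow_right hb)) ?_)
  · rw [← h a (q + 1)]
    exact inf_le_inf Ideal.mul_le_left Ideal.mul_le_left
  · rw [mul_comm]
    exact Ideal.mul_mono_right ((Ideal.pow_le_pow_right ha).trans
      (Ideal.pow_right_mono le_sup_left _))

theorem sup_pow_inf (h : ∀ a b : ℕ, X ^ a ⊓ Y ^ b = X ^ a * Y ^ b) (i q : ℕ) :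
    (X ⊔ Y) ^ (i + q + 1) ⊓ X ^ (i + 1) = X ^ (i + 1) * (X ⊔ Y) ^ q := by
  rw [sup_pow_add_eq, sup_inf_assoc_of_le _ Ideal.mul_le_left, inf_comm]
  have h1 := pow_mul_pow_inf h (a := i + 1) (b := 0) (i := i) (q := q) (by omega) (by omega)
  rw [pow_zero, mul_one] at h1
  rw [h1, sup_eq_left]
  exact Ideal.mul_mono_right ((Ideal.pow_le_pow_right (Nat.le_succ q)).trans
    (Ideal.pow_right_mono le_sup_right _))

theorem sup_pow_sup (i q : ℕ) :
    (X ⊔ Y) ^ (i + q + 1) ⊔ X ^ (i + 1) = X ^ (i + 1) ⊔ Y ^ (q + 1) * (X ⊔ Y) ^ i := by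
  have h : X ^ (i + 1) ⊔ X ^ (i + 1) * (X ⊔ Y) ^ q = X ^ (i + 1) := sup_eq_left.2 Ideal.mul_le_left
  rw [sup_pow_add_eq, sup_comm _ (X ^ (i + 1)), ← sup_assoc, h]

end IdealIdentities

section Bounds

variable {k : Type} [Field k] {σ : Type} [Fintype σ] [DecidableEq σ] {o : σ → ℕ}
  {X Y : Ideal (MvPolynomial σ k)} {α β : ℕ → ℤ}

theorem regIdeal_pow_mul_sup_pow_le (ho : Function.Injective o) (hX : IsHomogeneousIdeal k X)
    (hY : IsHomogeneousIdeal k Y) (hX0 : X ≠ ⊥) (hY0 : Y ≠ ⊥)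
    (hinf : ∀ a b : ℕ, X ^ a ⊓ Y ^ b = X ^ a * Y ^ b)
    (hreg : ∀ a b : ℕ, regIdeal k (X ^ a * Y ^ b) = α a + β b) {n : ℕ} {G : ℤ}
    (h₁ : ∀ a b, a + b = n → α a + β b ≤ G)
    (h₂ : ∀ a b, 1 ≤ a → 1 ≤ b → a + b = n + 1 → α a + β b ≤ G + 1) (i : ℕ) :
    ∀ q, i + q = n → regIdeal k (Y ^ q * (X ⊔ Y) ^ i) ≤ G := by
  induction i with
  | zero =>
    intro q hq
    have := hreg 0 q
    rw [pow_zero, one_mul] at this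
    rw [pow_zero, mul_one, this]
    exact h₁ 0 q hq
  | succ i ih =>
    intro q hq
    have h := pow_mul_pow_inf hinf (Nat.le_succ q) (Nat.le_succ i)
    rw [pow_mul_sup_pow_succ]
    refine regIdeal_sup_le ho ((hX.pow _).mul (hY.pow _)) ((hY.pow _).mul ((hX.sup hY).pow _)) ?_
      ?_ (ih (q + 1) (by omega)) ?_
    · rw [h]
      exact mul_ne_zero (pow_ne_zero _ hX0) (pow_ne_zero _ hY0)
    · rw [hreg]
      exact h₁ _ _ hq
    · rw [h, hreg]
      exact h₂ _ _ (by omega) (by omega) (by omega)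

theorem le_regIdeal_sup_pow (ho : Function.Injective o) (hX : IsHomogeneousIdeal k X)
    (hY : IsHomogeneousIdeal k Y) (hX0 : X ≠ ⊥) (hY0 : Y ≠ ⊥)
    (hinf : ∀ a b : ℕ, X ^ a ⊓ Y ^ b = X ^ a * Y ^ b)
    (hreg : ∀ a b : ℕ, regIdeal k (X ^ a * Y ^ b) = α a + β b) {n : ℕ} {G : ℤ}
    (h₁ : ∀ a b, a + b = n → α a + β b ≤ G)
    (h₂ : ∀ a b, 1 ≤ a → 1 ≤ b → a + b = n + 1 → α a + β b ≤ G + 1) (hβ0 : β 0 = 0) {i p : ℕ}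
    (hn : i + p + 1 = n) (hip : α (i + 1) + β (p + 1) = G + 1) (hβ : 2 ≤ β (p + 1)) :
    G ≤ regIdeal k ((X ⊔ Y) ^ n) := by
  have hu := regIdeal_pow_mul_sup_pow_le ho hX hY hX0 hY0 hinf hreg h₁ h₂ i (p + 1) (by omega)
  have hu' := regIdeal_pow_mul_sup_pow_le (n := n) (G := G) (α := β) (β := α) ho hY hX hY0 hX0
    (fun a b => by rw [inf_comm, hinf, mul_comm])
    (fun a b => by rw [mul_comm, hreg, add_comm])
    (fun a b hab => by rw [add_comm]; exact h₁ b a (by omega))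
    (fun a b ha hb hab => by rw [add_comm]; exact h₂ b a hb ha (by omega)) p (i + 1) (by omega)
  rw [sup_comm Y X] at hu'
  have hXi : regIdeal k (X ^ (i + 1)) = α (i + 1) := by
    have := hreg (i + 1) 0
    rwa [pow_zero, mul_one, hβ0, add_zero] at this
  have h0 : X ^ (i + 1) * Y ^ (p + 1) ≠ ⊥ := mul_ne_zero (pow_ne_zero _ hX0) (pow_ne_zero _ hY0)
  have hP0 : X ^ (i + 1) * (X ⊔ Y) ^ p ≠ ⊥ :=
    mul_ne_zero (pow_ne_zero _ hX0) (pow_ne_zero _ fun h => hX0 (le_bot_iff.1 (le_sup_left.trans h.le)))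
  have hi := pow_mul_pow_inf hinf (a := i + 1) (b := 0) (i := i) (q := p) (by omega) (by omega)
  rw [pow_zero, mul_one] at hi
  subst hn
  by_contra! hlt
  have hV : regIdeal k ((X ⊔ Y) ^ (i + p + 1) ⊔ X ^ (i + 1)) ≤ G - 1 := by
    refine regIdeal_sup_le ho ((hX.sup hY).pow _) (hX.pow _) ?_ (by omega) (by omega) ?_
    · rwa [sup_pow_inf hinf]
    · rw [sup_pow_inf hinf]
      omega
  rw [sup_pow_sup] at hV
  have := regIdeal_inf_le ho (hX.pow _) ((hY.pow _).mul ((hX.sup hY).pow _)) (by rwa [hi])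
    (by omega) hu hV
  rw [hi, hreg] at this
  omega

theorem regIdeal_sup_pow_eq (ho : Function.Injective o) (hX : IsHomogeneousIdeal k X)
    (hY : IsHomogeneousIdeal k Y) (hX0 : X ≠ ⊥) (hY0 : Y ≠ ⊥)
    (hinf : ∀ a b : ℕ, X ^ a ⊓ Y ^ b = X ^ a * Y ^ b)
    (hreg : ∀ a b : ℕ, regIdeal k (X ^ a * Y ^ b) = α a + β b)
    (hα0 : α 0 = 0) (hβ0 : β 0 = 0) (hα : ∀ n, n ≤ α n) (hβ : ∀ n, n ≤ β n) {n : ℕ} {G : ℤ}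
    (hn : 2 ≤ n) (h₁ : ∀ a b, a + b = n → α a + β b ≤ G)
    (h₂ : ∀ a b, 1 ≤ a → 1 ≤ b → a + b = n + 1 → α a + β b ≤ G + 1)
    (h₃ : ∃ a b, 1 ≤ a ∧ 1 ≤ b ∧ a + b = n + 1 ∧ α a + β b = G + 1) :
    regIdeal k ((X ⊔ Y) ^ n) = G := by
  refine le_antisymm ?_ ?_
  · have := regIdeal_pow_mul_sup_pow_le ho hX hY hX0 hY0 hinf hreg h₁ h₂ n 0 rfl
    rwa [pow_zero, one_mul] at this
  obtain ⟨a, b, ha, hb, hab, habG⟩ := h₃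
  obtain ⟨i, rfl⟩ := Nat.exists_eq_add_of_le' ha
  obtain ⟨p, rfl⟩ := Nat.exists_eq_add_of_le' hb
  by_cases hp : 1 ≤ p
  · have := hβ (p + 1)
    exact le_regIdeal_sup_pow ho hX hY hX0 hY0 hinf hreg h₁ h₂ hβ0 (by omega) habG
      (by push_cast at this; omega)
  · have := hα (i + 1)
    rw [sup_comm]
    exact le_regIdeal_sup_pow ho hY hX hY0 hX0
      (fun a b => by rw [inf_comm, hinf, mul_comm])
      (fun a b => by rw [mul_comm, hreg, add_comm])
      (fun a b hab => by rw [add_comm]; exact h₁ b a (by omega))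
      (fun a b ha hb hab => by rw [add_comm]; exact h₂ b a hb ha (by omega)) hα0
      (i := p) (p := i) (by omega) (by omega) (by push_cast at this; omega)

end Bounds

section Asymptotics

/-- The maximum of the bounds on `α a + β b` with `a + b = n + 1`, for eventually linear functions
`α` and `β`. -/
theorem eventually_linear_bounds {α β : ℕ → ℤ} {c d e f E F : ℤ} {mI mJ : ℕ} (hmI : 1 ≤ mI)
    (hmJ : 1 ≤ mJ) (hα0 : α 0 = 0) (hβ0 : β 0 = 0) (hα : ∀ n, n ≤ α n) (hβ : ∀ n, n ≤ β n)
    (hI : ∀ n, mI ≤ n → α n = d * n + e) (hJ : ∀ n, mJ ≤ n → β n = c * n + f) (hcd : d ≤ c)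
    (hE : IsGreatest {v : ℤ | ∃ i : ℕ, 1 ≤ i ∧ i ≤ mI ∧ v = α i - c * i} E)
    (hF : IsGreatest {v : ℤ | ∃ j : ℕ, 1 ≤ j ∧ j ≤ mJ ∧ v = β j - d * j} F) {n : ℕ}
    (hn : mI + mJ ≤ n) :
    (∀ a b, a + b = n → α a + β b ≤ max (c * (n + 1) + f + E) (d * (n + 1) + e + F) - 1) ∧
    (∀ a b, 1 ≤ a → 1 ≤ b → a + b = n + 1 →
      α a + β b ≤ max (c * (n + 1) + f + E) (d * (n + 1) + e + F) - 1 + 1) ∧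
    ∃ a b, 1 ≤ a ∧ 1 ≤ b ∧ a + b = n + 1 ∧
      α a + β b = max (c * (n + 1) + f + E) (d * (n + 1) + e + F) - 1 + 1 := by
  have hd : 1 ≤ d := by
    by_contra! h
    have h1 := hα (mI + e.toNat + 1)
    rw [hI _ (by omega)] at h1
    have h2 : d * ((mI + e.toNat + 1 : ℕ) : ℤ) ≤ 0 :=
      mul_nonpos_of_nonpos_of_nonneg (by omega) (by omega)
    push_cast at h1 h2
    have := Int.self_le_toNat e
    omega
  have hEub : ∀ a, 1 ≤ a → α a - c * a ≤ E := by
    intro a ha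
    by_cases h : a ≤ mI
    · exact hE.2 ⟨a, ha, h, rfl⟩
    · refine le_trans ?_ (hE.2 ⟨mI, hmI, le_rfl, rfl⟩)
      rw [hI _ le_rfl, hI a (by omega)]
      have : (mI : ℤ) ≤ a := by omega
      nlinarith
  have hFub : ∀ b, 1 ≤ b → b ≤ mJ → β b - d * b ≤ F := fun b hb hb' => hF.2 ⟨b, hb, hb', rfl⟩
  have hE1 : 1 - c ≤ E := by
    have h1 := hEub 1 le_rfl
    have h2 := hα 1
    push_cast at h1 h2
    linarith
  have hF1 : 1 - d ≤ F := by
    have h1 := hFub 1 le_rfl hmJ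
    have h2 := hβ 1
    push_cast at h1 h2
    linarith
  obtain ⟨M, hM⟩ : ∃ M, M = max (c * ((n : ℤ) + 1) + f + E) (d * ((n : ℤ) + 1) + e + F) := ⟨_, rfl⟩
  have hM1 : c * (n + 1) + f + E ≤ M := hM ▸ le_max_left _ _
  have hM2 : d * (n + 1) + e + F ≤ M := hM ▸ le_max_right _ _
  rw [← hM]
  refine ⟨fun a b hab => ?_, fun a b ha hb hab => ?_, ?_⟩
  · have hab' : (a : ℤ) = n - b := by omega
    by_cases hb : mJ ≤ b
    · rw [hJ b hb]
      rcases Nat.eq_zero_or_pos a with rfl | ha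
      · rw [hα0]
        have : (b : ℤ) = n := by omega
        rw [this]
        linarith
      · have := hEub a ha
        rw [hab'] at this
        linarith
    · have ha : mI ≤ a := by omega
      rw [hI a ha]
      rcases Nat.eq_zero_or_pos b with rfl | hb'
      · rw [hβ0, hab']
        push_cast
        linarith
      · have := hFub b hb' (by omega)
        rw [hab']
        linarith
  · have hab' : (a : ℤ) = n + 1 - b := by omega
    by_cases hb' : mJ ≤ b
    · have := hEub a ha
      rw [hJ b hb']
      rw [hab'] at this
      linarith
    · rw [hI a (by omega)]
      have := hFub b hb (by omega)
      rw [hab']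
      linarith
  · rcases le_total (d * ((n : ℤ) + 1) + e + F) (c * ((n : ℤ) + 1) + f + E) with h | h
    · obtain ⟨i, hi1, hi, hiE⟩ := hE.1
      refine ⟨i, n + 1 - i, hi1, by omega, by omega, ?_⟩
      rw [hM, max_eq_left h, hJ _ (by omega), hiE, Nat.cast_sub (by omega)]
      push_cast
      ring
    · obtain ⟨j, hj1, hj, hjF⟩ := hF.1
      refine ⟨n + 1 - j, j, by omega, hj1, by omega, ?_⟩
      rw [hM, max_eq_right h, hI _ (by omega), hjF, Nat.cast_sub (by omega)]
      push_cast
      ring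

theorem isGreatest_sSup_of_range (g : ℕ → ℤ) {m : ℕ} (hm : 1 ≤ m) :
    IsGreatest {v : ℤ | ∃ i : ℕ, 1 ≤ i ∧ i ≤ m ∧ v = g i}
      (sSup {v : ℤ | ∃ i : ℕ, 1 ≤ i ∧ i ≤ m ∧ v = g i}) := by
  have hfin : {v : ℤ | ∃ i : ℕ, 1 ≤ i ∧ i ≤ m ∧ v = g i}.Finite :=
    ((Set.finite_Icc 1 m).image g).subset fun v ⟨i, h1, h2, h3⟩ => ⟨i, ⟨h1, h2⟩, h3.symm⟩
  have hne : {v : ℤ | ∃ i : ℕ, 1 ≤ i ∧ i ≤ m ∧ v = g i}.Nonempty := ⟨g 1, 1, le_rfl, hm, rfl⟩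
  exact ⟨hne.csSup_mem hfin, fun v hv => le_csSup hfin.bddAbove hv⟩

end Asymptotics

/-- The regularity of `(I + J)^n` in terms of the regularities of the powers of `I` and `J`. -/
theorem regIdeal_sumIJ_pow_eq {k : Type} [Field k] {r s : ℕ} {I : Ideal (PA k r)}
    {J : Ideal (PB k s)} (hI0 : I ≠ ⊥) (hI1 : I ≠ ⊤) (hIh : IsHomogeneousIdeal k I) (hJ0 : J ≠ ⊥)
    (hJ1 : J ≠ ⊤) (hJh : IsHomogeneousIdeal k J) {n : ℕ} {G : ℤ} (hn : 2 ≤ n)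
    (h₁ : ∀ a b, a + b = n → regIdeal k (I ^ a) + regIdeal k (J ^ b) ≤ G)
    (h₂ : ∀ a b, 1 ≤ a → 1 ≤ b → a + b = n + 1 →
      regIdeal k (I ^ a) + regIdeal k (J ^ b) ≤ G + 1)
    (h₃ : ∃ a b, 1 ≤ a ∧ 1 ≤ b ∧ a + b = n + 1 ∧
      regIdeal k (I ^ a) + regIdeal k (J ^ b) = G + 1) :
    regIdeal k (sumIJ k I J ^ n) = G := by
  have hA := Fin.val_injective (n := r)
  have hB := Fin.val_injective (n := s)
  have hN : ∀ i : Fin r, (i : ℕ) < r := fun i => i.2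
  refine regIdeal_sup_pow_eq (X := extA k I) (Y := extB k J) (ordSum_injective hA hB hN)
    (hIh.map_rename Sum.inl_injective) (hJh.map_rename Sum.inr_injective)
    (map_rename_ne_bot Sum.inl_injective hI0) (map_rename_ne_bot Sum.inr_injective hJ0)
    (fun a b => ?_) (fun a b => ?_) ?_ ?_ (le_regIdeal_pow hA hIh hI0 hI1)
    (le_regIdeal_pow hB hJh hJ0 hJ1) hn h₁ h₂ h₃
  · unfold extA extB
    rw [← Ideal.map_pow, ← Ideal.map_pow, map_inf_map_eq_mul]
  · unfold extA extB
    rw [← Ideal.map_pow, ← Ideal.map_pow, regIdeal_map_mul_map hA hB hN (hIh.pow a) (hJh.pow b)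
      (pow_ne_zero a hI0) (pow_ne_zero b hJ0)]
  · rw [pow_zero, Ideal.one_eq_top, regIdeal_top hA]
  · rw [pow_zero, Ideal.one_eq_top, regIdeal_top hB]

end

end PaperHTT

open PaperHTT in
/-- Theorem 5.6: if `reg I^n = d*n + e` for `n ≥ lin(I)` and `reg J^n = c*n + f` for
`n ≥ lin(J)` with `c ≥ d`, and `e* = max_(1 ≤ i ≤ lin(I)) (reg I^i - c*i)`,
`f* = max_(1 ≤ j ≤ lin(J)) (reg J^j - d*j)`, then for `n ≫ 0`:
`reg (I+J)^n = c*(n+1) + f + e* - 1` if `c > d`, and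
`reg (I+J)^n = d*(n+1) + max (f + e*) (e + f*) - 1` if `c = d`. -/
theorem reg_power_sum_asymptotic
    (k : Type) [Field k] (r s : ℕ)
    (I : Ideal (PA k r)) (J : Ideal (PB k s))
    (hI0 : I ≠ ⊥) (hI1 : I ≠ ⊤) (hIh : IsHomogeneousIdeal k I)
    (hJ0 : J ≠ ⊥) (hJ1 : J ≠ ⊤) (hJh : IsHomogeneousIdeal k J)
    (d e c f : ℤ) (mI mJ : ℕ) (hmI : 1 ≤ mI) (hmJ : 1 ≤ mJ)
    (hI : ∀ n : ℕ, mI ≤ n → regIdeal k (I ^ n) = d * (n : ℤ) + e)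
    (hImin : ∀ m : ℕ, 1 ≤ m →
      (∀ n : ℕ, m ≤ n → regIdeal k (I ^ n) = d * (n : ℤ) + e) → mI ≤ m)
    (hJ : ∀ n : ℕ, mJ ≤ n → regIdeal k (J ^ n) = c * (n : ℤ) + f)
    (hJmin : ∀ m : ℕ, 1 ≤ m →
      (∀ n : ℕ, m ≤ n → regIdeal k (J ^ n) = c * (n : ℤ) + f) → mJ ≤ m)
    (hcd : d ≤ c) :
    ∃ N : ℕ, ∀ n : ℕ, N ≤ n →
      (d < c → regIdeal k ((sumIJ k I J) ^ n) =
        c * ((n : ℤ) + 1) + f +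
          sSup {v : ℤ | ∃ i : ℕ, 1 ≤ i ∧ i ≤ mI ∧ v = regIdeal k (I ^ i) - c * (i : ℤ)} - 1) ∧
      (c = d → regIdeal k ((sumIJ k I J) ^ n) =
        d * ((n : ℤ) + 1) +
          max (f + sSup {v : ℤ | ∃ i : ℕ, 1 ≤ i ∧ i ≤ mI ∧ v = regIdeal k (I ^ i) - c * (i : ℤ)})
            (e + sSup {v : ℤ | ∃ j : ℕ, 1 ≤ j ∧ j ≤ mJ ∧ v = regIdeal k (J ^ j) - d * (j : ℤ)}) - 1) := by
  have hE := isGreatest_sSup_of_range (fun i => regIdeal k (I ^ i) - c * (i : ℤ)) hmI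
  have hF := isGreatest_sSup_of_range (fun j => regIdeal k (J ^ j) - d * (j : ℤ)) hmJ
  generalize sSup {v : ℤ | ∃ i : ℕ, 1 ≤ i ∧ i ≤ mI ∧ v = regIdeal k (I ^ i) - c * (i : ℤ)} = E
    at hE ⊢
  generalize sSup {v : ℤ | ∃ j : ℕ, 1 ≤ j ∧ j ≤ mJ ∧ v = regIdeal k (J ^ j) - d * (j : ℤ)} = F
    at hF ⊢
  have key (n : ℕ) (hn : mI + mJ ≤ n) : regIdeal k ((sumIJ k I J) ^ n) =
      max (c * ((n : ℤ) + 1) + f + E) (d * ((n : ℤ) + 1) + e + F) - 1 := by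
    obtain ⟨h₁, h₂, h₃⟩ := eventually_linear_bounds hmI hmJ
      (by rw [pow_zero, Ideal.one_eq_top, regIdeal_top Fin.val_injective])
      (by rw [pow_zero, Ideal.one_eq_top, regIdeal_top Fin.val_injective])
      (le_regIdeal_pow Fin.val_injective hIh hI0 hI1)
      (le_regIdeal_pow Fin.val_injective hJh hJ0 hJ1) hI hJ hcd hE hF hn
    exact regIdeal_sumIJ_pow_eq hI0 hI1 hIh hJ0 hJ1 hJh (by omega) h₁ h₂ h₃
  refine ⟨mI + mJ + (e + F - f - E).toNat, fun n hn => ⟨fun h => ?_, fun h => ?_⟩⟩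
  · have hn' : e + F - f - E ≤ n := by omega
    rw [key n (by omega), max_eq_left]
    nlinarith
  · rw [key n (by omega), h, add_assoc, add_assoc, max_add_add_left]
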